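/- For every POMDP Γ and every initial belief p₁ ∈ Δ(K), the value equals the supremum of the payoff over finite-memory strategies: v_∞(p₁) = sup{γ^{p₁}_∞(σ) : σ a strategy with finite memory}. -/

import Mathlib

open MeasureTheory Filter

namespace PomdpPaper

/-- A belief (probability vector) on `Fin n`. -/
def IsBelief {n : ℕ} (p : Fin n → ℝ) : Prop :=
  (∀ k, 0 ≤ p k) ∧ ∑ k, p k = 1

/-- The measure on a finite type associated with a probability vector. -/
noncomputable def vecMeasure {α : Type*} [Fintype α] [MeasurableSpace α] (p : α → ℝ) :
    Measure α :=
  ∑ x : α, ENNReal.ofReal (p x) • Measure.dirac x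

/-- The Dirac belief at a point. -/
def diracBelief {n : ℕ} (k : Fin n) : Fin n → ℝ := fun k' => if k' = k then 1 else 0

/-- The `i`-th binary digit of a real number `x ∈ [0,1)` (as a real number `0` or `1`). -/
noncomputable def digitR (x : ℝ) (i : ℕ) : ℝ :=
  if ⌊x * 2 ^ (i + 1)⌋ % 2 = 1 then 1 else 0

/-- From one uniform seed `x ∈ [0,1)`, a sequence `unif x 0, unif x 1, …` of
(independent, uniformly distributed on `[0,1]`) real numbers, obtained by splitting the
binary digits of `x` along the pairing function. -/
noncomputable def unif (x : ℝ) (m : ℕ) : ℝ :=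
  ∑' j : ℕ, digitR x (Nat.pair m j) / 2 ^ (j + 1)

open Classical in
/-- Inverse-transform sampling from a probability vector on `Fin n` using a seed `u ∈ [0,1]`. -/
noncomputable def sampleFin {n : ℕ} (hn : 0 < n) (p : Fin n → ℝ) (u : ℝ) : Fin n :=
  let s : Finset (Fin n) :=
    Finset.univ.filter fun y : Fin n => u < ∑ z ∈ Finset.univ.filter fun z : Fin n => z ≤ y, p z
  if hs : s.Nonempty then s.min' hs else ⟨0, hn⟩

/-- Inverse-transform sampling from a probability vector on a finite nonempty type. -/
noncomputable def sampleOn {β : Type*} [Fintype β] [Nonempty β] (p : β → ℝ) (u : ℝ) : β :=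
  (Fintype.equivFin β).symm
    (sampleFin Fintype.card_pos (fun i => p ((Fintype.equivFin β).symm i)) u)

/-- A POMDP with states `Fin nK`, actions `Fin nA`, signals `Fin nS`, transition function `q`
and reward function `g` with values in `[0,1]`. -/
structure POMDP where
  nK : ℕ
  nA : ℕ
  nS : ℕ
  hK : 0 < nK
  hA : 0 < nA
  hS : 0 < nS
  q : Fin nK → Fin nA → Fin nK × Fin nS → ℝ
  q_nonneg : ∀ k a y, 0 ≤ q k a y
  q_sum : ∀ k a, ∑ y, q k a y = 1
  g : Fin nK → Fin nA → ℝ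
  g_nonneg : ∀ k a, 0 ≤ g k a
  g_le_one : ∀ k a, g k a ≤ 1

namespace POMDP

variable (Γ : POMDP)

/-- The state space. -/
abbrev K := Fin Γ.nK
/-- The action space. -/
abbrev A := Fin Γ.nA
/-- The signal space. -/
abbrev S := Fin Γ.nS

instance : Nonempty Γ.K := ⟨⟨0, Γ.hK⟩⟩
instance : Nonempty Γ.A := ⟨⟨0, Γ.hA⟩⟩
instance : Nonempty Γ.S := ⟨⟨0, Γ.hS⟩⟩

/-- A history: the finite sequence of past actions and signals. -/
abbrev Hist := List (Γ.A × Γ.S)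

/-- A (pure) strategy: a map from histories to actions. -/
abbrev Strategy := Γ.Hist → Γ.A

/-- The sample space carrying all the randomness: an initial state together with a
uniform seed in `[0,1)` used to draw all the transitions. -/
abbrev Env := Γ.K × ℝ

/-- The probability measure on the sample space induced by the initial belief `p1`:
the initial state is drawn according to `p1`, the seed uniformly on `[0,1)`. -/
noncomputable def envMeasure (p1 : Γ.K → ℝ) : Measure Γ.Env :=
  (vecMeasure p1).prod (volume.restrict (Set.Ico (0 : ℝ) 1))

/-- The trajectory: `(Γ.traj σ ω m).1` is the state `k_{m+1}` at stage `m+1` and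
`(Γ.traj σ ω m).2` is the history before stage `m+1` (of length `m`), when the
decision-maker uses strategy `σ` and the randomness is `ω`.  At each stage, the pair
(new state, signal) is drawn from `q` via inverse-transform sampling from a fresh
uniform variable. -/
noncomputable def traj (σ : Γ.Strategy) (ω : Γ.Env) : ℕ → Γ.K × Γ.Hist
  | 0 => (ω.1, [])
  | m + 1 =>
    let p := traj σ ω m
    let a := σ p.2
    let y := sampleOn (Γ.q p.1 a) (unif ω.2 m)
    (y.1, p.2 ++ [(a, y.2)])

/-- The state `k_{m+1}` at stage `m+1` (`m` is 0-indexed). -/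
noncomputable def state (σ : Γ.Strategy) (ω : Γ.Env) (m : ℕ) : Γ.K := (Γ.traj σ ω m).1

/-- The history before stage `m+1` (a list of length `m`). -/
noncomputable def hist (σ : Γ.Strategy) (ω : Γ.Env) (m : ℕ) : Γ.Hist := (Γ.traj σ ω m).2

/-- The action `a_{m+1}` played at stage `m+1`. -/
noncomputable def act (σ : Γ.Strategy) (ω : Γ.Env) (m : ℕ) : Γ.A := σ (Γ.hist σ ω m)

/-- The reward `g_{m+1}` obtained at stage `m+1`. -/
noncomputable def rew (σ : Γ.Strategy) (ω : Γ.Env) (m : ℕ) : ℝ :=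
  Γ.g (Γ.state σ ω m) (Γ.act σ ω m)

/-- The average reward over the first `n` stages. -/
noncomputable def avg (σ : Γ.Strategy) (ω : Γ.Env) (n : ℕ) : ℝ :=
  (1 / n : ℝ) * ∑ m ∈ Finset.range n, Γ.rew σ ω m

/-- The probability of an event under initial belief `p1` (the strategy `σ` is recorded for
readability; the underlying measure does not depend on it). -/
noncomputable def prob (p1 : Γ.K → ℝ) (_σ : Γ.Strategy) (E : Set Γ.Env) : ℝ :=
  (Γ.envMeasure p1 E).toReal

/-- The long-run average payoff `γ^{p1}_∞(σ) = E[liminf (1/n) ∑ g_m]`. -/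
noncomputable def pay (p1 : Γ.K → ℝ) (σ : Γ.Strategy) : ℝ :=
  ∫ ω, atTop.liminf (Γ.avg σ ω) ∂(Γ.envMeasure p1)

/-- The payoff starting from a deterministic state `k`, i.e. `γ^k_∞(σ)`. -/
noncomputable def payK (k : Γ.K) (σ : Γ.Strategy) : ℝ := Γ.pay (diracBelief k) σ

/-- The value `v_∞(p1)`. -/
noncomputable def val (p1 : Γ.K → ℝ) : ℝ := ⨆ σ : Γ.Strategy, Γ.pay p1 σ

/-- A strategy has finite memory if it is implemented by a finite-state transducer. -/
def FiniteMemory (σ : Γ.Strategy) : Prop :=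
  ∃ (n : ℕ) (m0 : Fin n) (σa : Fin n → Γ.A) (σu : Fin n → Γ.A × Γ.S → Fin n),
    ∀ h : Γ.Hist, σ h = σa (h.foldl σu m0)

/-- A blind MDP: the signal set is a singleton. -/
def Blind : Prop := Γ.nS = 1

/-- The strategy induced by a sequence of actions `a_1, a_2, …` (`as m` is the action played
at stage `m+1`, regardless of the observed history). -/
def blindStrat (as : ℕ → Γ.A) : Γ.Strategy := fun h => as h.length

end POMDP

/-- A sequence is eventually periodic if it is periodic with some period `T ≥ 1` from
some stage `N` on. -/
def EventuallyPeriodic {α : Type*} (as : ℕ → α) : Prop :=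
  ∃ T ≥ 1, ∃ N ≥ 1, ∀ m ≥ N, as (m + T) = as m




open ProbabilityTheory

noncomputable abbrev mu0 : Measure ℝ := volume.restrict (Set.Ico (0 : ℝ) 1)

instance : IsProbabilityMeasure mu0 := ⟨by simp⟩

lemma measurable_digitR (i : ℕ) : Measurable (fun x => digitR x i) := by
  unfold digitR
  refine Measurable.ite ?_ measurable_const measurable_const
  have h : Measurable (fun x : ℝ => ⌊x * 2 ^ (i + 1)⌋) := Int.measurable_floor.comp (by fun_prop)
  exact h (MeasurableSet.of_discrete (s := {z : ℤ | z % 2 = 1}))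

lemma digitR_succ (x : ℝ) (i : ℕ) : digitR x (i + 1) = digitR (Int.fract (2 * x)) i := by
  unfold digitR
  have h : Int.fract (2 * x) * 2 ^ (i + 1) = x * 2 ^ (i + 1 + 1) - ((⌊2 * x⌋ * 2 ^ (i + 1) : ℤ) : ℝ) := by
    unfold Int.fract
    push_cast
    ring
  rw [h, Int.floor_sub_intCast]
  have h2 : (⌊2 * x⌋ * 2 ^ (i + 1) : ℤ) = 2 * (⌊2 * x⌋ * 2 ^ i) := by ring
  rw [h2]
  congr 1
  apply propext
  omega

lemma digit_half (c : ℤ) (B : Set ℝ) (hB : MeasurableSet B) (hc : c = 0 ∨ c = 1) :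
    mu0 {x | ⌊2 * x⌋ = c ∧ Int.fract (2 * x) ∈ B} = ENNReal.ofReal (1 / 2) * mu0 B := by
  have hm : MeasurableSet {x : ℝ | ⌊2 * x⌋ = c ∧ Int.fract (2 * x) ∈ B} := by
    apply MeasurableSet.inter
    · exact (Int.measurable_floor.comp (by fun_prop : Measurable fun x : ℝ => 2 * x))
        (MeasurableSet.of_discrete (s := {z : ℤ | z = c}))
    · exact (measurable_fract.comp (by fun_prop : Measurable fun x : ℝ => 2 * x)) hB
  rw [Measure.restrict_apply hm, Measure.restrict_apply hB]
  have : {x : ℝ | ⌊2 * x⌋ = c ∧ Int.fract (2 * x) ∈ B} ∩ Set.Ico 0 1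
      = (fun x => 2 * x) ⁻¹' ((fun x => x - (c : ℝ)) ⁻¹' (B ∩ Set.Ico 0 1)) := by
    ext x
    simp only [Set.mem_inter_iff, Set.mem_ofPred_eq, Set.mem_Ico, Set.mem_preimage]
    constructor
    · rintro ⟨⟨h1, h2⟩, h3, h4⟩
      have : Int.fract (2 * x) = 2 * x - c := by rw [Int.fract, h1]
      rw [this] at h2
      rw [Int.floor_eq_iff] at h1
      exact ⟨h2, by linarith, by linarith⟩
    · rintro ⟨h2, h3, h4⟩
      have h1 : ⌊2 * x⌋ = c := by rw [Int.floor_eq_iff]; constructor <;> linarith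
      have : Int.fract (2 * x) = 2 * x - c := by rw [Int.fract, h1]
      rw [this]
      refine ⟨⟨h1, h2⟩, ?_, ?_⟩ <;> rcases hc with rfl | rfl <;> push_cast at * <;> linarith
  rw [this, Real.volume_preimage_mul_left (by norm_num)]
  have h5 : (fun x : ℝ => x - (c : ℝ)) = fun x => x + (-(c:ℝ)) := by ext; ring
  rw [h5, measure_preimage_add_right]
  congr 2
  rw [abs_of_pos (by norm_num)]
  norm_num

noncomputable def beta : Measure ℝ := mu0.map (fun x => digitR x 0)

instance : IsProbabilityMeasure beta :=
  Measure.isProbabilityMeasure_map (measurable_digitR 0).aemeasurable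

lemma digitR_zero_eq (x : ℝ) (hx : x ∈ Set.Ico (0 : ℝ) 1) :
    (⌊2 * x⌋ = 0 ∧ digitR x 0 = 0) ∨ (⌊2 * x⌋ = 1 ∧ digitR x 0 = 1) := by
  have h0 : 0 ≤ ⌊2 * x⌋ := Int.floor_nonneg.2 (by linarith [hx.1])
  have h1 : ⌊2 * x⌋ < 2 := Int.floor_lt.2 (by push_cast; linarith [hx.2])
  have h : digitR x 0 = if ⌊2 * x⌋ % 2 = 1 then 1 else 0 := by
    unfold digitR; simp [mul_comm]
  have : ⌊2 * x⌋ = 0 ∨ ⌊2 * x⌋ = 1 := by omega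
  rcases this with h2 | h2 <;> simp [h, h2]

open Classical in
lemma digit_joint_aux (t B : Set ℝ) (hB : MeasurableSet B) :
    mu0 {x | digitR x 0 ∈ t ∧ Int.fract (2 * x) ∈ B} =
      ((if (0 : ℝ) ∈ t then ENNReal.ofReal (1 / 2) else 0)
        + (if (1 : ℝ) ∈ t then ENNReal.ofReal (1 / 2) else 0)) * mu0 B := by
  have hmf : MeasurableSet {x : ℝ | ⌊2 * x⌋ = 0} :=
    (Int.measurable_floor.comp (by fun_prop : Measurable fun x : ℝ => 2 * x))
        (MeasurableSet.of_discrete (s := {z : ℤ | z = 0}))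
  rw [← measure_inter_add_sdiff _ hmf]
  have e1 : mu0 ({x | digitR x 0 ∈ t ∧ Int.fract (2 * x) ∈ B} ∩ {x : ℝ | ⌊2 * x⌋ = 0})
      = (if (0 : ℝ) ∈ t then ENNReal.ofReal (1 / 2) else 0) * mu0 B := by
    split_ifs with h
    · rw [← digit_half 0 B hB (Or.inl rfl)]
      apply measure_congr
      filter_upwards [ae_restrict_mem measurableSet_Ico] with x hx
      apply propext
      change (digitR x 0 ∈ t ∧ Int.fract (2 * x) ∈ B) ∧ ⌊2 * x⌋ = 0 ↔ ⌊2 * x⌋ = 0 ∧ Int.fract (2 * x) ∈ B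
      rcases digitR_zero_eq x hx with ⟨h1, h2⟩ | ⟨h1, h2⟩ <;>
        simp only [h1, h2, h] <;> tauto
    · rw [zero_mul]
      refine (measure_congr ?_).trans measure_empty
      filter_upwards [ae_restrict_mem measurableSet_Ico] with x hx
      apply propext
      change (digitR x 0 ∈ t ∧ Int.fract (2 * x) ∈ B) ∧ ⌊2 * x⌋ = 0 ↔ False
      rcases digitR_zero_eq x hx with ⟨h1, h2⟩ | ⟨h1, h2⟩ <;>
        simp only [h1, h2, h] <;> tauto
  have e2 : mu0 ({x | digitR x 0 ∈ t ∧ Int.fract (2 * x) ∈ B} \ {x : ℝ | ⌊2 * x⌋ = 0})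
      = (if (1 : ℝ) ∈ t then ENNReal.ofReal (1 / 2) else 0) * mu0 B := by
    split_ifs with h
    · rw [← digit_half 1 B hB (Or.inr rfl)]
      apply measure_congr
      filter_upwards [ae_restrict_mem measurableSet_Ico] with x hx
      apply propext
      change (digitR x 0 ∈ t ∧ Int.fract (2 * x) ∈ B) ∧ ¬ ⌊2 * x⌋ = 0 ↔ ⌊2 * x⌋ = 1 ∧ Int.fract (2 * x) ∈ B
      rcases digitR_zero_eq x hx with ⟨h1, h2⟩ | ⟨h1, h2⟩ <;>
        simp only [h1, h2, h] <;> tauto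
    · rw [zero_mul]
      refine (measure_congr ?_).trans measure_empty
      filter_upwards [ae_restrict_mem measurableSet_Ico] with x hx
      apply propext
      change (digitR x 0 ∈ t ∧ Int.fract (2 * x) ∈ B) ∧ ¬ ⌊2 * x⌋ = 0 ↔ False
      rcases digitR_zero_eq x hx with ⟨h1, h2⟩ | ⟨h1, h2⟩ <;>
        simp only [h1, h2, h] <;> tauto
  rw [e1, e2, add_mul]

lemma digit_joint (t B : Set ℝ) (ht : MeasurableSet t) (hB : MeasurableSet B) :
    mu0 {x | digitR x 0 ∈ t ∧ Int.fract (2 * x) ∈ B} = beta t * mu0 B := by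
  rw [digit_joint_aux t B hB, beta, Measure.map_apply (measurable_digitR 0) ht]
  have := digit_joint_aux t Set.univ MeasurableSet.univ
  simp only [Set.mem_univ, and_true, measure_univ, mul_one] at this
  rw [← this]
  rfl

lemma digit_indep (n : ℕ) (t : ℕ → Set ℝ) (ht : ∀ i, MeasurableSet (t i)) :
    mu0 {x | ∀ i < n, digitR x i ∈ t i} = ∏ i ∈ Finset.range n, beta (t i) := by
  induction n generalizing t with
  | zero => simp
  | succ n ih =>
    have hm : MeasurableSet {x | ∀ i < n, digitR x i ∈ t (i + 1)} := by
      have : {x | ∀ i < n, digitR x i ∈ t (i + 1)} = ⋂ i, ⋂ (_ : i < n), (fun x => digitR x i) ⁻¹' t (i+1) := by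
        ext; simp
      rw [this]
      exact MeasurableSet.iInter fun i => MeasurableSet.iInter fun _ => measurable_digitR i (ht _)
    rw [Finset.prod_range_succ', mul_comm, ← ih (fun i => t (i + 1)) (fun i => ht _),
      ← digit_joint _ _ (ht 0) hm]
    congr 1
    ext x
    simp only [Set.mem_ofPred_eq, ← digitR_succ]
    constructor
    · intro h
      exact ⟨h 0 (by omega), fun i hi => h (i + 1) (by omega)⟩
    · rintro ⟨h0, h⟩ i hi
      rcases i with _ | i
      · exact h0
      · exact h i (by omega)

lemma digit_law : mu0.map (fun x i => digitR x i) = Measure.infinitePi (fun _ : ℕ => beta) := by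
  classical
  refine Measure.eq_infinitePi _ fun s t ht => ?_
  rw [Measure.map_apply (measurable_pi_lambda _ fun i => measurable_digitR i)
    (MeasurableSet.pi s.countable_toSet fun _ _ => ht _)]
  obtain ⟨n, hn⟩ := s.exists_nat_subset_range
  have := digit_indep n (fun i => if i ∈ s then t i else Set.univ) (fun i => by
    split_ifs
    exacts [ht i, MeasurableSet.univ])
  rw [← Finset.prod_subset hn (fun i _ hi => by simp [hi])] at this
  rw [Finset.prod_congr rfl (fun i hi => by rw [if_pos hi])] at this
  rw [← this]
  congr 1
  ext x
  simp only [Set.mem_preimage, Set.mem_pi, SetLike.mem_coe, Set.mem_ofPred_eq]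
  constructor
  · intro h i _
    split_ifs with his
    exacts [h i his, trivial]
  · intro h i hi
    have := h i (Finset.mem_range.1 (hn hi))
    rwa [if_pos hi] at this

noncomputable def binSum (b : ℕ → ℝ) : ℝ := ∑' j : ℕ, b j / 2 ^ (j + 1)

lemma measurable_binSum : Measurable binSum := by
  unfold binSum
  exact Measurable.tsum (fun j => by fun_prop)

lemma binSum_digitR (x : ℝ) (hx : x ∈ Set.Ico (0 : ℝ) 1) : binSum (fun i => digitR x i) = x := by
  have := Real.hasSum_ofDigitsTerm_digits x (b := 2) (by norm_num) hx
  unfold binSum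
  refine Eq.trans ?_ this.tsum_eq
  congr 1
  ext j
  unfold Real.ofDigitsTerm Real.digits digitR
  have hpos : 0 ≤ x * 2 ^ (j + 1) := mul_nonneg hx.1 (by positivity)
  have h1 : (⌊x * 2 ^ (j + 1)⌋ : ℤ) = (⌊x * 2 ^ (j + 1)⌋₊ : ℤ) :=
    (Int.natCast_floor_eq_floor hpos).symm
  beta_reduce
  rw [h1]
  simp only [Fin.ofNat_eq_cast, Nat.cast_ofNat, div_eq_mul_inv]
  congr 1
  rw [Fin.val_natCast]
  rcases Nat.mod_two_eq_zero_or_one (⌊x * 2 ^ (j + 1)⌋₊) with h | h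
  · rw [if_neg (by omega), h]; simp
  · rw [if_pos (by omega), h]; simp

lemma binSum_law : (Measure.infinitePi (fun _ : ℕ => beta)).map binSum = mu0 := by
  rw [← digit_law, Measure.map_map measurable_binSum
    (measurable_pi_lambda _ fun i => measurable_digitR i)]
  conv_rhs => rw [← Measure.map_id (μ := mu0)]
  apply Measure.map_congr
  filter_upwards [ae_restrict_mem measurableSet_Ico] with x hx
  exact binSum_digitR x hx

lemma unif_law : mu0.map (fun x m => unif x m) = Measure.infinitePi (fun _ : ℕ => mu0) := by
  have hd : Measurable (fun (x : ℝ) (i : ℕ) => digitR x i) :=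
    measurable_pi_lambda _ fun i => measurable_digitR i
  have h1 : (Measure.infinitePi (fun _ : ℕ => beta)).map (fun b (p : ℕ × ℕ) => b (Nat.pair p.1 p.2))
      = Measure.infinitePi (fun _ : ℕ × ℕ => beta) := by
    refine Measure.eq_infinitePi _ fun s t ht => ?_
    have hm : Measurable (fun (b : ℕ → ℝ) (p : ℕ × ℕ) => b (Nat.pair p.1 p.2)) := by fun_prop
    rw [Measure.map_apply hm (MeasurableSet.pi s.countable_toSet fun _ _ => ht _)]
    have : (fun (b : ℕ → ℝ) (p : ℕ × ℕ) => b (Nat.pair p.1 p.2)) ⁻¹' (Set.pi s t)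
      = Set.pi (s.map Nat.pairEquiv.toEmbedding) (fun i => t i.unpair) := by
      ext b
      simp only [Set.mem_preimage, Set.mem_pi, Finset.coe_map, Set.mem_image]
      constructor
      · rintro h _ ⟨p, hp, rfl⟩
        change b (Nat.pair p.1 p.2) ∈ t (Nat.unpair (Nat.pair p.1 p.2))
        rw [Nat.unpair_pair]
        exact h p hp
      · intro h p hp
        simpa using h (Nat.pair p.1 p.2) ⟨p, hp, rfl⟩
    rw [this, Measure.infinitePi_pi _ (fun i _ => ht _), Finset.prod_map]
    refine Finset.prod_congr rfl fun p _ => ?_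
    change beta (t (Nat.unpair (Nat.pair p.1 p.2))) = _
    rw [Nat.unpair_pair]
  have h2 := Measure.infinitePi_map_curry (fun (_ _ : ℕ) => beta)
  rw [← h1, Measure.map_map (by fun_prop) (by fun_prop), ← digit_law,
    Measure.map_map (by fun_prop) hd] at h2
  have h3 := Measure.infinitePi_map_pi (μ := fun _ : ℕ => Measure.infinitePi (fun _ : ℕ => beta))
    (f := fun _ => binSum) (fun _ => measurable_binSum)
  simp only [binSum_law] at h3
  rw [← h3, ← digit_law, ← h2, Measure.map_map _ _]
  · rfl
  · exact measurable_pi_lambda _ fun i => measurable_binSum.comp (measurable_pi_apply i)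
  · fun_prop

lemma measurable_unif (m : ℕ) : Measurable (fun x => unif x m) := by
  unfold unif
  exact Measurable.tsum fun j => (measurable_digitR _).div_const _

lemma unif_map (m : ℕ) : mu0.map (fun x => unif x m) = mu0 := by
  have h := congrArg (Measure.map (fun u : ℕ → ℝ => u m)) unif_law
  rw [Measure.map_map (by fun_prop) (measurable_pi_lambda _ fun i => measurable_unif i),
    Measure.infinitePi_map_eval] at h
  exact h

lemma unif_indep : iIndepFun (fun m x => unif x m) mu0 := by
  rw [iIndepFun_iff_map_fun_eq_infinitePi_map (fun m => measurable_unif m)]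
  simp only [unif_map]
  exact unif_law

/-- sigma-algebra generated by the first `m` uniform variables. -/
@[reducible] noncomputable def sigG (m : ℕ) : MeasurableSpace ℝ :=
  ⨆ i ∈ {i : ℕ | i < m}, MeasurableSpace.comap (fun x => unif x i) inferInstance

lemma sigG_le (m : ℕ) : sigG m ≤ (inferInstance : MeasurableSpace ℝ) :=
  iSup₂_le fun i _ => (measurable_unif i).comap_le

lemma sigG_mono {m n : ℕ} (h : m ≤ n) : sigG m ≤ sigG n :=
  biSup_mono fun i hi => lt_of_lt_of_le hi h

lemma measurable_unif_sigG {i m : ℕ} (h : i < m) : Measurable[sigG m] (fun x => unif x i) :=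
  (comap_measurable (fun x => unif x i)).mono
    (le_iSup₂ (f := fun i (_ : i ∈ {i : ℕ | i < m}) =>
      MeasurableSpace.comap (fun x => unif x i) inferInstance) i h) le_rfl

lemma sigG_indep (m : ℕ) :
    Indep (sigG m) (MeasurableSpace.comap (fun x => unif x m) inferInstance) mu0 := by
  have := indep_iSup_of_disjoint (fun i => (measurable_unif i).comap_le)
    unif_indep.iIndep (S := {i : ℕ | i < m}) (T := {m}) (by simp)
  simpa [sigG] using this



open ProbabilityTheory

lemma sampleFin_eq_iff {n : ℕ} (hn : 0 < n) (p : Fin n → ℝ) (hp : ∀ i, 0 ≤ p i)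
    (hs : ∑ i, p i = 1) (u : ℝ) (hu : u ∈ Set.Ico (0 : ℝ) 1) (i : Fin n) :
    sampleFin hn p u = i ↔ u ∈ Set.Ico (∑ z ∈ Finset.univ.filter (fun z => z < i), p z)
      (∑ z ∈ Finset.univ.filter (fun z => z ≤ i), p z) := by
  classical
  unfold sampleFin
  have hne : (Finset.univ.filter fun y : Fin n =>
      u < ∑ z ∈ Finset.univ.filter fun z : Fin n => z ≤ y, p z).Nonempty := by
    refine ⟨⟨n - 1, by omega⟩, ?_⟩
    rw [Finset.mem_filter]
    refine ⟨Finset.mem_univ _, ?_⟩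
    rw [Finset.filter_true_of_mem, hs]
    · exact hu.2
    · intro z _
      rw [Fin.le_def]
      have := z.2
      simp only
      omega
  simp only
  have e : ∀ (inst : DecidablePred fun y : Fin n =>
      u < ∑ z ∈ Finset.univ.filter fun z : Fin n => z ≤ y, p z), True := fun _ => trivial
  rw [dif_pos (by convert hne)]
  rw [Finset.min'_eq_iff]
  simp only [Finset.mem_filter, Finset.mem_univ, true_and, Set.mem_Ico]
  constructor
  · rintro ⟨h1, h2⟩
    refine ⟨?_, h1⟩
    by_contra hcon
    push Not at hcon
    rcases Nat.eq_zero_or_pos i.1 with h0 | h0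
    · rw [Finset.filter_false_of_mem] at hcon
      · simp at hcon; linarith [hu.1]
      · intro z _
        rw [Fin.lt_def]; omega
    · have := h2 ⟨i.1 - 1, by omega⟩ (by
        have hf : Finset.univ.filter (fun z : Fin n => z ≤ ⟨i.1 - 1, by omega⟩)
            = Finset.univ.filter (fun z => z < i) := by
          ext z
          simp only [Finset.mem_filter, Finset.mem_univ, true_and, Fin.le_def, Fin.lt_def]
          omega
        rw [hf]; exact hcon)
      rw [Fin.le_def] at this
      simp only at this
      omega
  · rintro ⟨h1, h2⟩
    refine ⟨h2, fun j hj => ?_⟩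
    by_contra hcon
    push Not at hcon
    have : ∑ z ∈ Finset.univ.filter (fun z => z ≤ j), p z ≤ ∑ z ∈ Finset.univ.filter (fun z => z < i), p z := by
      apply Finset.sum_le_sum_of_subset_of_nonneg
      · intro z
        simp only [Finset.mem_filter, Finset.mem_univ, true_and]
        intro hz
        exact lt_of_le_of_lt hz hcon
      · intros; exact hp _
    linarith

lemma measurable_sampleFin {n : ℕ} (hn : 0 < n) (p : Fin n → ℝ) :
    Measurable (sampleFin hn p) := by
  classical
  let s : ℝ → Fin n → Prop := fun u y => u < ∑ z ∈ Finset.univ.filter fun z : Fin n => z ≤ y, p z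
  have hs : Measurable s := by
    refine measurable_pi_lambda _ fun y => ?_
    exact measurable_id.lt measurable_const
  let f : (Fin n → Prop) → Fin n := fun P =>
    if hs : (Finset.univ.filter P).Nonempty then (Finset.univ.filter P).min' hs else ⟨0, hn⟩
  have : sampleFin hn p = f ∘ s := by
    ext u
    simp only [sampleFin, f, s, Function.comp]
  rw [this]
  exact (measurable_of_finite f).comp hs

lemma measurable_sampleOn {β : Type*} [Fintype β] [Nonempty β] [MeasurableSpace β] (p : β → ℝ) :
    Measurable (sampleOn p) := by
  unfold sampleOn
  exact (measurable_of_finite _).comp (measurable_sampleFin _ _)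

lemma sampleOn_measure {β : Type*} [Fintype β] [Nonempty β] (p : β → ℝ) (hp : ∀ b, 0 ≤ p b)
    (hs : ∑ b, p b = 1) (b : β) : mu0 {u | sampleOn p u = b} = ENNReal.ofReal (p b) := by
  classical
  set e := Fintype.equivFin β
  set p' : Fin (Fintype.card β) → ℝ := fun i => p (e.symm i) with hp'
  have hs' : ∑ i, p' i = 1 := by rw [← hs]; exact e.symm.sum_comp p
  have h0 : ∀ i, 0 ≤ p' i := fun i => hp _
  have hle : ∑ z ∈ Finset.univ.filter (fun z => z ≤ e b), p' z
      = ∑ z ∈ Finset.univ.filter (fun z => z < e b), p' z + p' (e b) := by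
    rw [add_comm, ← Finset.sum_insert (by simp)]
    congr 1
    ext z
    simp [le_iff_eq_or_lt]
  have : mu0 {u | sampleOn p u = b} = mu0 (Set.Ico (∑ z ∈ Finset.univ.filter (fun z => z < e b), p' z)
      (∑ z ∈ Finset.univ.filter (fun z => z ≤ e b), p' z)) := by
    apply measure_congr
    filter_upwards [ae_restrict_mem measurableSet_Ico] with x hx
    apply propext
    change sampleOn p x = b ↔ x ∈ Set.Ico _ _
    rw [← sampleFin_eq_iff Fintype.card_pos p' h0 hs' x hx]
    unfold sampleOn
    rw [Equiv.symm_apply_eq]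
  rw [this, Measure.restrict_apply measurableSet_Ico, Set.inter_eq_left.2, Real.volume_Ico, hle]
  · congr 1
    simp [hp']
  · refine Set.Ico_subset_Ico (Finset.sum_nonneg fun i _ => h0 i) ?_
    rw [← hs']
    exact Finset.sum_le_sum_of_subset_of_nonneg (Finset.filter_subset _ _) fun i _ _ => h0 i

namespace POMDP
variable (Γ : POMDP)

/-- One-step operator on functions of (state, history). -/
noncomputable def Pop (σ : Γ.Strategy) (φ : Γ.K × Γ.Hist → ℝ) (z : Γ.K × Γ.Hist) : ℝ :=
  ∑ y, Γ.q z.1 (σ z.2) y * φ (y.1, z.2 ++ [(σ z.2, y.2)])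

lemma traj_succ (σ : Γ.Strategy) (ω : Γ.Env) (m : ℕ) : Γ.traj σ ω (m + 1) =
    ((sampleOn (Γ.q (Γ.traj σ ω m).1 (σ (Γ.traj σ ω m).2)) (unif ω.2 m)).1,
      (Γ.traj σ ω m).2 ++ [(σ (Γ.traj σ ω m).2,
        (sampleOn (Γ.q (Γ.traj σ ω m).1 (σ (Γ.traj σ ω m).2)) (unif ω.2 m)).2)]) := rfl

lemma traj_length (σ : Γ.Strategy) (ω : Γ.Env) (m : ℕ) : (Γ.traj σ ω m).2.length = m := by
  induction m with
  | zero => rfl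
  | succ m ih => rw [traj_succ]; simp [ih]

lemma measurable_traj (σ : Γ.Strategy) (k : Γ.K) (m : ℕ) :
    @Measurable _ _ (sigG m) ⊤ (fun x => Γ.traj σ (k, x) m) := by
  induction m with
  | zero =>
    intro E _
    change @MeasurableSet ℝ (sigG 0) {x : ℝ | ((k, []) : Γ.K × Γ.Hist) ∈ E}
    exact MeasurableSet.const _
  | succ m ih =>
    intro E _
    have : (fun x => Γ.traj σ (k, x) (m + 1)) ⁻¹' E = ⋃ z : Γ.K × Γ.Hist,
        ((fun x => Γ.traj σ (k, x) m) ⁻¹' {z} ∩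
          (fun x => unif x m) ⁻¹' {u | ((sampleOn (Γ.q z.1 (σ z.2)) u).1,
            z.2 ++ [(σ z.2, (sampleOn (Γ.q z.1 (σ z.2)) u).2)]) ∈ E}) := by
      ext x
      simp only [Set.mem_preimage, Set.mem_iUnion, Set.mem_inter_iff, Set.mem_singleton_iff,
        exists_eq_left', Set.mem_ofPred_eq, traj_succ]
    rw [this]
    refine MeasurableSet.iUnion fun z => MeasurableSet.inter ?_ ?_
    · exact sigG_mono (Nat.le_succ m) _ (ih (by trivial))
    · refine measurable_unif_sigG (Nat.lt_succ_self m) ?_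
      exact measurable_sampleOn (Γ.q z.1 (σ z.2)) (MeasurableSet.of_discrete
        (s := {y | (y.1, z.2 ++ [(σ z.2, y.2)]) ∈ E}))

lemma measurable_traj' (σ : Γ.Strategy) (k : Γ.K) (m : ℕ) {β : Type*} [mβ : MeasurableSpace β]
    (φ : Γ.K × Γ.Hist → β) : Measurable[sigG m] (fun x => φ (Γ.traj σ (k, x) m)) :=
  (@measurable_from_top _ _ mβ φ).comp (Γ.measurable_traj σ k m)

/-- all pairs (state, history of length m) -/
noncomputable def VV (m : ℕ) : Finset (Γ.K × Γ.Hist) :=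
  Finset.univ ×ˢ (List.finite_length_eq (Γ.A × Γ.S) m).toFinset

lemma traj_mem_VV (σ : Γ.Strategy) (ω : Γ.Env) (m : ℕ) : Γ.traj σ ω m ∈ Γ.VV m := by
  simp [VV, traj_length]

lemma step_k (σ : Γ.Strategy) (k : Γ.K) (m : ℕ) (F : ℝ → ℝ) (hF : Measurable[sigG m] F)
    (C : ℝ) (hC : ∀ x, |F x| ≤ C) (φ : Γ.K × Γ.Hist → ℝ) :
    ∫ x, F x * φ (Γ.traj σ (k, x) (m + 1)) ∂mu0 = ∫ x, F x * Γ.Pop σ φ (Γ.traj σ (k, x) m) ∂mu0 := by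
  classical
  let Fz : Γ.K × Γ.Hist → ℝ → ℝ := fun z x => F x * (if Γ.traj σ (k, x) m = z then 1 else 0)
  let Yz : Γ.K × Γ.Hist → Γ.K × Γ.S → ℝ → ℝ := fun z y x =>
    if sampleOn (Γ.q z.1 (σ z.2)) (unif x m) = y then 1 else 0
  have hFz : ∀ z, Measurable[sigG m] (Fz z) := fun z =>
    hF.mul (Γ.measurable_traj' σ k m (fun z' => if z' = z then (1 : ℝ) else 0))
  have hYm : ∀ (z : Γ.K × Γ.Hist) (y : Γ.K × Γ.S), Measurable (fun u => if sampleOn (Γ.q z.1 (σ z.2)) u = y then (1 : ℝ) else 0) :=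
    fun z y => (measurable_of_finite (fun y' => if y' = y then (1 : ℝ) else 0)).comp
      (measurable_sampleOn (Γ.q z.1 (σ z.2)))
  have hYz : ∀ z y, Measurable[MeasurableSpace.comap (fun x => unif x m) inferInstance] (Yz z y) :=
    fun z y => (hYm z y).comp (comap_measurable (fun x => unif x m))
  have hFz' : ∀ z, Measurable (Fz z) := fun z => (hFz z).mono (sigG_le m) le_rfl
  have hYz' : ∀ z y, Measurable (Yz z y) := fun z y => (hYm z y).comp (measurable_unif m)
  have hFi : ∀ z, Integrable (Fz z) mu0 := fun z =>
    Integrable.of_bound (hFz' z).aestronglyMeasurable C (ae_of_all _ fun x => by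
      simp only [Fz, Real.norm_eq_abs, abs_mul]
      have := hC x
      split_ifs <;> simp <;> linarith [abs_nonneg (F x)])
  have hFYi : ∀ z y, Integrable (fun x => Fz z x * Yz z y x) mu0 := fun z y =>
    (hFi z).mul_bdd (c := 1) (hYz' z y).aestronglyMeasurable (ae_of_all _ fun x => by
      simp only [Yz]; split_ifs <;> simp)
  have hYint : ∀ z y, ∫ x, Yz z y x ∂mu0 = Γ.q z.1 (σ z.2) y := by
    intro z y
    have h1 : ∫ x, Yz z y x ∂mu0 = ∫ u, (if sampleOn (Γ.q z.1 (σ z.2)) u = y then (1 : ℝ) else 0) ∂mu0 := by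
      conv_rhs => rw [← unif_map m]
      rw [integral_map (measurable_unif m).aemeasurable (hYm z y).aestronglyMeasurable]
    rw [h1]
    have h2 : (fun u => if sampleOn (Γ.q z.1 (σ z.2)) u = y then (1 : ℝ) else 0)
        = Set.indicator {u | sampleOn (Γ.q z.1 (σ z.2)) u = y} 1 := by
      ext u; simp [Set.indicator_apply]
    rw [h2, integral_indicator_one, measureReal_def, sampleOn_measure _ (Γ.q_nonneg _ _) (Γ.q_sum _ _),
      ENNReal.toReal_ofReal (Γ.q_nonneg _ _ _)]
    exact measurable_sampleOn (Γ.q z.1 (σ z.2)) (MeasurableSet.of_discrete (s := {y' | y' = y}))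
  have hind : ∀ z y, ∫ x, Fz z x * Yz z y x ∂mu0 = (∫ x, Fz z x ∂mu0) * Γ.q z.1 (σ z.2) y := by
    intro z y
    rw [← hYint z y]
    have hI : IndepFun (Fz z) (Yz z y) mu0 := by
      rw [IndepFun_iff_Indep]
      exact indep_of_indep_of_le_left (indep_of_indep_of_le_right (sigG_indep m)
        (hYz z y).comap_le) (hFz z).comap_le
    exact hI.integral_fun_mul_eq_mul_integral (hFz' z).aestronglyMeasurable
      (hYz' z y).aestronglyMeasurable
  have eL : ∀ x, F x * φ (Γ.traj σ (k, x) (m + 1)) = ∑ z ∈ Γ.VV m, ∑ y,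
      φ (y.1, z.2 ++ [(σ z.2, y.2)]) * (Fz z x * Yz z y x) := by
    intro x
    rw [Finset.sum_eq_single (Γ.traj σ (k, x) m) (fun z _ hz => by
        simp [Fz, hz.symm]) (fun h => absurd (Γ.traj_mem_VV σ _ m) h)]
    rw [Finset.sum_eq_single (sampleOn (Γ.q (Γ.traj σ (k, x) m).1 (σ (Γ.traj σ (k, x) m).2)) (unif x m))
      (fun y _ hy => by simp [Yz, hy.symm]) (fun h => absurd (Finset.mem_univ _) h)]
    rw [traj_succ]
    simp [Fz, Yz, mul_comm]
  have eR : ∀ x, F x * Γ.Pop σ φ (Γ.traj σ (k, x) m) = ∑ z ∈ Γ.VV m, Γ.Pop σ φ z * Fz z x := by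
    intro x
    rw [Finset.sum_eq_single (Γ.traj σ (k, x) m) (fun z _ hz => by
        simp [Fz, hz.symm]) (fun h => absurd (Γ.traj_mem_VV σ _ m) h)]
    simp [Fz, mul_comm]
  simp_rw [eL, eR]
  rw [integral_finsetSum _ (fun z _ => integrable_finsetSum _ fun y _ => (hFYi z y).const_mul _),
    integral_finsetSum _ (fun z _ => (hFi z).const_mul _)]
  refine Finset.sum_congr rfl fun z _ => ?_
  rw [integral_finsetSum _ (fun y _ => (hFYi z y).const_mul _), integral_const_mul, Pop, Finset.sum_mul]
  refine Finset.sum_congr rfl fun y _ => ?_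
  rw [integral_const_mul, hind]
  ring

lemma env_eq (p1 : Γ.K → ℝ) : Γ.envMeasure p1 =
    ∑ k, ENNReal.ofReal (p1 k) • (mu0.map (fun x => (k, x))) := by
  unfold envMeasure vecMeasure
  have : ∀ s : Finset Γ.K, (∑ x ∈ s, ENNReal.ofReal (p1 x) • Measure.dirac x).prod mu0
      = ∑ k ∈ s, ENNReal.ofReal (p1 k) • (mu0.map (fun x => (k, x))) := by
    classical
    intro s
    induction s using Finset.induction_on with
    | empty => simp
    | insert a s ha ih =>
      rw [Finset.sum_insert ha, Finset.sum_insert ha, Measure.add_prod, ih, Measure.prod_smul_left,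
        Measure.dirac_prod]
  exact this _

lemma env_ae (p1 : Γ.K → ℝ) (E : Γ.Env → Prop) (hE : ∀ k, ∀ᵐ x ∂mu0, E (k, x)) :
    ∀ᵐ ω ∂(Γ.envMeasure p1), E ω := by
  rw [env_eq, ae_iff, Measure.finsetSum_apply]
  refine Finset.sum_eq_zero fun k _ => ?_
  rw [Measure.smul_apply]
  have : (mu0.map (fun x => (k, x))) {a : Γ.Env | ¬E a} = 0 := by
    have hm : MeasurableEmbedding (fun x : ℝ => (k, x)) := measurableEmbedding_prodMk_left k
    rw [hm.map_apply]
    exact hE k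
  rw [this]; simp

lemma env_integral (p1 : Γ.K → ℝ) (hp : ∀ k, 0 ≤ p1 k) (f : Γ.Env → ℝ)
    (hf : ∀ k, Integrable (fun x => f (k, x)) mu0) :
    Integrable f (Γ.envMeasure p1) ∧
    ∫ ω, f ω ∂(Γ.envMeasure p1) = ∑ k, p1 k * ∫ x, f (k, x) ∂mu0 := by
  have hm : ∀ k : Γ.K, MeasurableEmbedding (fun x : ℝ => (k, x)) := fun k => measurableEmbedding_prodMk_left k
  have hi : ∀ k : Γ.K, Integrable f (ENNReal.ofReal (p1 k) • (mu0.map (fun x => (k, x)))) := by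
    intro k
    apply Integrable.smul_measure _ ENNReal.ofReal_ne_top
    rw [(hm k).integrable_map_iff]
    exact hf k
  rw [env_eq]
  refine ⟨integrable_finsetSum_measure.2 fun k _ => hi k, ?_⟩
  rw [integral_finsetSum_measure fun k _ => hi k]
  refine Finset.sum_congr rfl fun k _ => ?_
  rw [integral_smul_measure, (hm k).integral_map, ENNReal.toReal_ofReal (hp k)]
  rfl

end POMDP


open ProbabilityTheory

lemma ae_tendsto_zero_of_summable (f : ℕ → ℝ → ℝ) (hf : ∀ n, Measurable (f n)) (hn : ∀ n x, 0 ≤ f n x)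
    (hi : ∀ n, Integrable (f n) mu0) (a : ℕ → ℝ) (ha : Summable a) (hb : ∀ n, ∫ x, f n x ∂mu0 ≤ a n) :
    ∀ᵐ x ∂mu0, Tendsto (fun n => f n x) atTop (nhds 0) := by
  have h1 : ∫⁻ x, ∑' n, ENNReal.ofReal (f n x) ∂mu0 ≠ ⊤ := by
    rw [lintegral_tsum (fun n => (hf n).ennreal_ofReal.aemeasurable)]
    have : ∀ n, ∫⁻ x, ENNReal.ofReal (f n x) ∂mu0 ≤ ENNReal.ofReal (a n) := by
      intro n
      rw [← ofReal_integral_eq_lintegral_ofReal (hi n) (ae_of_all _ (hn n))]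
      exact ENNReal.ofReal_le_ofReal (hb n)
    exact ne_top_of_le_ne_top ha.tsum_ofReal_ne_top (ENNReal.tsum_le_tsum this)
  have h2 := ae_lt_top (Measurable.tsum fun n => (hf n).ennreal_ofReal) h1
  filter_upwards [h2] with x hx
  have h3 := ENNReal.tendsto_atTop_zero_of_tsum_ne_top hx.ne
  have h4 := (ENNReal.tendsto_toReal ENNReal.zero_ne_top).comp h3
  simpa [Function.comp_def, ENNReal.toReal_ofReal (hn _ x)] using h4

namespace POMDP
variable (Γ : POMDP)

lemma Pop_bound (σ : Γ.Strategy) (φ : Γ.K × Γ.Hist → ℝ) (C : ℝ) (hφ : ∀ z, |φ z| ≤ C) (z) :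
    |Γ.Pop σ φ z| ≤ C := by
  unfold Pop
  refine (Finset.abs_sum_le_sum_abs _ _).trans ?_
  calc _ ≤ ∑ y, Γ.q z.1 (σ z.2) y * C := by
        refine Finset.sum_le_sum fun y _ => ?_
        rw [abs_mul, abs_of_nonneg (Γ.q_nonneg _ _ _)]
        exact mul_le_mul_of_nonneg_left (hφ _) (Γ.q_nonneg _ _ _)
    _ = C := by rw [← Finset.sum_mul, Γ.q_sum, one_mul]

/-- martingale differences -/
noncomputable def DD (σ : Γ.Strategy) (φ : Γ.K × Γ.Hist → ℝ) (k : Γ.K) (m : ℕ) (x : ℝ) : ℝ :=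
  φ (Γ.traj σ (k, x) (m + 1)) - Γ.Pop σ φ (Γ.traj σ (k, x) m)

lemma DD_bound (σ : Γ.Strategy) (φ : Γ.K × Γ.Hist → ℝ) (C : ℝ) (hφ : ∀ z, |φ z| ≤ C) (k m x) :
    |Γ.DD σ φ k m x| ≤ 2 * C := by
  unfold DD
  have h1 := abs_le.1 (hφ (Γ.traj σ (k, x) (m + 1)))
  have h2 := abs_le.1 (Γ.Pop_bound σ φ C hφ (Γ.traj σ (k, x) m))
  rw [abs_le]; constructor <;> linarith [h1.1, h1.2, h2.1, h2.2]

lemma DD_meas (σ : Γ.Strategy) (φ : Γ.K × Γ.Hist → ℝ) (k m) :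
    Measurable[sigG (m + 1)] (Γ.DD σ φ k m) :=
  (Γ.measurable_traj' σ k (m + 1) φ).sub
    ((Γ.measurable_traj' σ k m (Γ.Pop σ φ)).mono (sigG_mono (Nat.le_succ m)) le_rfl)

lemma DD_orth (σ : Γ.Strategy) (φ : Γ.K × Γ.Hist → ℝ) (C : ℝ) (hφ : ∀ z, |φ z| ≤ C) (k m)
    (F : ℝ → ℝ) (hF : Measurable[sigG m] F) (C' : ℝ) (hC : ∀ x, |F x| ≤ C') :
    ∫ x, F x * Γ.DD σ φ k m x ∂mu0 = 0 := by
  have hb : ∀ (ψ : ℝ → ℝ) (_ : Measurable ψ) (_ : ∀ x, |ψ x| ≤ C),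
      Integrable (fun x => F x * ψ x) mu0 := by
    intro ψ hψ hψ2
    refine Integrable.of_bound ((hF.mono (sigG_le m) le_rfl).mul hψ).aestronglyMeasurable (C' * C)
      (ae_of_all _ fun x => ?_)
    rw [Real.norm_eq_abs, abs_mul]
    exact mul_le_mul (hC x) (hψ2 x) (abs_nonneg _) ((abs_nonneg _).trans (hC x))
  simp only [DD, mul_sub]
  rw [integral_sub (hb _ ((Γ.measurable_traj' σ k (m + 1) φ).mono (sigG_le _) le_rfl) (fun x => hφ _))
    (hb _ ((Γ.measurable_traj' σ k m (Γ.Pop σ φ)).mono (sigG_le _) le_rfl)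
      (fun x => Γ.Pop_bound σ φ C hφ _)), Γ.step_k σ k m F hF C' hC φ, sub_self]

/-- partial sums -/
noncomputable def SD (σ : Γ.Strategy) (φ : Γ.K × Γ.Hist → ℝ) (k : Γ.K) (n : ℕ) (x : ℝ) : ℝ :=
  ∑ m ∈ Finset.range n, Γ.DD σ φ k m x

lemma SD_meas (σ : Γ.Strategy) (φ : Γ.K × Γ.Hist → ℝ) (k n) :
    Measurable[sigG n] (Γ.SD σ φ k n) := by
  unfold SD
  refine @Finset.measurable_fun_sum _ _ _ _ _ _ (sigG n) _ _ fun m hm => ?_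
  exact (Γ.DD_meas σ φ k m).mono (sigG_mono (Finset.mem_range.1 hm)) le_rfl

lemma SD_bound (σ : Γ.Strategy) (φ : Γ.K × Γ.Hist → ℝ) (C : ℝ) (hφ : ∀ z, |φ z| ≤ C) (k n x) :
    |Γ.SD σ φ k n x| ≤ n * (2 * C) := by
  unfold SD
  refine (Finset.abs_sum_le_sum_abs _ _).trans ?_
  refine (Finset.sum_le_sum fun m _ => Γ.DD_bound σ φ C hφ k m x).trans ?_
  simp

lemma SD_sq (σ : Γ.Strategy) (φ : Γ.K × Γ.Hist → ℝ) (C : ℝ) (hφ : ∀ z, |φ z| ≤ C) (k n) :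
    ∫ x, (Γ.SD σ φ k n x) ^ 2 ∂mu0 ≤ n * (2 * C) ^ 2 := by
  induction n with
  | zero => simp [SD]
  | succ n ih =>
    have mS := (Γ.SD_meas σ φ k n).mono (sigG_le n) le_rfl
    have mD := (Γ.DD_meas σ φ k n).mono (sigG_le _) le_rfl
    have i1 : Integrable (fun x => (Γ.SD σ φ k n x) ^ 2) mu0 :=
      Integrable.of_bound (mS.pow_const 2).aestronglyMeasurable ((n * (2 * C)) ^ 2) (ae_of_all _ fun x => by
        rw [norm_pow]; exact pow_le_pow_left₀ (norm_nonneg _) (Γ.SD_bound σ φ C hφ k n x) 2)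
    have i2 : Integrable (fun x => (Γ.DD σ φ k n x) ^ 2) mu0 :=
      Integrable.of_bound (mD.pow_const 2).aestronglyMeasurable ((2 * C) ^ 2) (ae_of_all _ fun x => by
        rw [norm_pow]; exact pow_le_pow_left₀ (norm_nonneg _) (Γ.DD_bound σ φ C hφ k n x) 2)
    have i3 : Integrable (fun x => 2 * (Γ.SD σ φ k n x * Γ.DD σ φ k n x)) mu0 := by
      refine Integrable.const_mul (Integrable.of_bound (mS.mul mD).aestronglyMeasurable (n * (2 * C) * (2 * C))
        (ae_of_all _ fun x => ?_)) _
      rw [Pi.mul_apply, Real.norm_eq_abs, abs_mul]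
      exact mul_le_mul (Γ.SD_bound σ φ C hφ k n x) (Γ.DD_bound σ φ C hφ k n x) (abs_nonneg _)
        ((abs_nonneg _).trans (Γ.SD_bound σ φ C hφ k n x))
    have e : ∀ x, (Γ.SD σ φ k (n + 1) x) ^ 2 = (Γ.SD σ φ k n x) ^ 2 +
        2 * (Γ.SD σ φ k n x * Γ.DD σ φ k n x) + (Γ.DD σ φ k n x) ^ 2 := by
      intro x
      have : Γ.SD σ φ k (n + 1) x = Γ.SD σ φ k n x + Γ.DD σ φ k n x := by
        simp [SD, Finset.sum_range_succ]
      rw [this]; ring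
    simp_rw [e]
    have i13 : Integrable (fun x => (Γ.SD σ φ k n x) ^ 2 +
        2 * (Γ.SD σ φ k n x * Γ.DD σ φ k n x)) mu0 := i1.add i3
    rw [integral_add i13 i2, integral_add i1 i3, integral_const_mul,
      Γ.DD_orth σ φ C hφ k n _ (Γ.SD_meas σ φ k n) _ (Γ.SD_bound σ φ C hφ k n)]
    have : ∫ x, (Γ.DD σ φ k n x) ^ 2 ∂mu0 ≤ ∫ x, (2 * C) ^ 2 ∂mu0 := by
      refine integral_mono i2 (integrable_const _) fun x => ?_
      have := pow_le_pow_left₀ (abs_nonneg _) (Γ.DD_bound σ φ C hφ k n x) 2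
      rwa [sq_abs] at this
    rw [integral_const] at this
    simp only [probReal_univ, one_smul] at this
    push_cast
    linarith

lemma lln (σ : Γ.Strategy) (φ : Γ.K × Γ.Hist → ℝ) (C : ℝ) (hφ : ∀ z, |φ z| ≤ C) (k) :
    ∀ᵐ x ∂mu0, Tendsto (fun n : ℕ => Γ.SD σ φ k (n ^ 2) x / (n ^ 2 : ℕ)) atTop (nhds 0) := by
  have mS := fun n => (Γ.SD_meas σ φ k n).mono (sigG_le n) le_rfl
  have key := ae_tendsto_zero_of_summable (fun n x => (Γ.SD σ φ k (n ^ 2) x / (n ^ 2 : ℕ)) ^ 2)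
    (fun n => ((mS _).div_const _).pow_const 2) (fun n x => sq_nonneg _)
    (fun n => Integrable.of_bound (((mS _).div_const _).pow_const 2).aestronglyMeasurable
      (((n ^ 2 : ℕ) * (2 * C) / (n ^ 2 : ℕ)) ^ 2) (ae_of_all _ fun x => by
        rw [norm_pow, norm_div]
        refine pow_le_pow_left₀ (by positivity) ?_ 2
        rw [Real.norm_natCast]
        gcongr
        exact Γ.SD_bound σ φ C hφ k _ x))
    (fun n => (1 / (n : ℝ) ^ 2) * (2 * C) ^ 2)
    ((Real.summable_one_div_nat_pow.2 (by norm_num)).mul_right _)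
    (fun n => by
      simp_rw [div_pow]
      rw [integral_div]
      refine (div_le_div_of_nonneg_right (Γ.SD_sq σ φ C hφ k (n ^ 2)) (by positivity)).trans ?_
      rcases Nat.eq_zero_or_pos n with h | h
      · subst h; simp
      · have : (n : ℝ) ≠ 0 := by positivity
        apply le_of_eq
        push_cast
        field_simp)
  filter_upwards [key] with x hx
  have := hx.sqrt
  simp only [Real.sqrt_sq_eq_abs, Real.sqrt_zero] at this
  exact (tendsto_zero_iff_abs_tendsto_zero _).2 this

/-- a.s. every transition has positive probability -/
lemma ae_pos (σ : Γ.Strategy) (k) : ∀ᵐ x ∂mu0, ∀ m,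
    ∃ y, 0 < Γ.q (Γ.traj σ (k, x) m).1 (σ (Γ.traj σ (k, x) m).2) y ∧
      Γ.traj σ (k, x) (m + 1) = (y.1, (Γ.traj σ (k, x) m).2 ++ [(σ (Γ.traj σ (k, x) m).2, y.2)]) := by
  rw [ae_all_iff]
  intro m
  have hz : ∀ᵐ x ∂mu0, ∀ z : Γ.K × Γ.Hist, ∀ y, sampleOn (Γ.q z.1 (σ z.2)) (unif x m) = y →
      Γ.q z.1 (σ z.2) y ≠ 0 := by
    rw [ae_all_iff]; intro z
    rw [ae_all_iff]; intro y
    by_cases h : Γ.q z.1 (σ z.2) y = 0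
    · have h1 := sampleOn_measure _ (Γ.q_nonneg z.1 (σ z.2)) (Γ.q_sum _ _) y
      rw [h, ENNReal.ofReal_zero] at h1
      conv at h1 => rw [← unif_map m]
      have hms : MeasurableSet {u | sampleOn (Γ.q z.1 (σ z.2)) u = y} :=
        measurable_sampleOn (Γ.q z.1 (σ z.2)) (MeasurableSet.of_discrete (s := {y' | y' = y}))
      rw [Measure.map_apply (measurable_unif m) hms] at h1
      rw [ae_iff]
      refine measure_mono_null ?_ h1
      intro x hx
      simp only [Set.mem_ofPred_eq, not_forall] at hx
      exact hx.1
    · exact ae_of_all _ fun x _ => h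
  filter_upwards [hz] with x hx
  refine ⟨_, ?_, Γ.traj_succ σ (k, x) m⟩
  exact lt_of_le_of_ne (Γ.q_nonneg _ _ _) (hx _ _ rfl).symm

end POMDP


open ProbabilityTheory

lemma tendsto_natSqrt : Tendsto Nat.sqrt atTop atTop := by
  refine tendsto_atTop_atTop.2 fun b => ⟨b * b, fun a ha => ?_⟩
  exact Nat.le_sqrt.2 ha

lemma bdd_liminf_aux (u : ℕ → ℝ) (h0 : ∀ n, 0 ≤ u n) (h1 : ∀ n, u n ≤ 1) :
    IsCoboundedUnder (· ≥ ·) atTop u ∧ IsBoundedUnder (· ≥ ·) atTop u := by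
  constructor
  · exact (isBoundedUnder_of ⟨1, h1⟩ : IsBoundedUnder (· ≤ ·) atTop u).isCoboundedUnder_ge
  · exact isBoundedUnder_of ⟨0, h0⟩

lemma liminf_mem (u : ℕ → ℝ) (h0 : ∀ n, 0 ≤ u n) (h1 : ∀ n, u n ≤ 1) :
    0 ≤ atTop.liminf u ∧ atTop.liminf u ≤ 1 := by
  obtain ⟨hc, hb⟩ := bdd_liminf_aux u h0 h1
  refine ⟨le_liminf_of_le hc (Eventually.of_forall h0), ?_⟩
  exact liminf_le_of_le hb fun b hb => by
    obtain ⟨n, hn⟩ := hb.exists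
    exact hn.trans (h1 n)

lemma real_liminf (r : ℕ → ℝ) (h0 : ∀ n, 0 ≤ r n) (h1 : ∀ n, r n ≤ 1) (S : ℕ → ℝ) (γ B : ℝ) (m0 : ℕ)
    (hS : Tendsto (fun n : ℕ => S (n ^ 2) / (n ^ 2 : ℕ)) atTop (nhds 0))
    (h : ∀ n ≥ m0, n * γ - B + S n ≤ ∑ m ∈ Finset.range n, r m) :
    γ ≤ atTop.liminf (fun n : ℕ => (1 / n : ℝ) * ∑ m ∈ Finset.range n, r m) := by
  have hs0 : ∀ n : ℕ, 0 ≤ ∑ m ∈ Finset.range n, r m := fun n => Finset.sum_nonneg fun i _ => h0 i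
  have hs1 : ∀ n : ℕ, ∑ m ∈ Finset.range n, r m ≤ n := fun n => by
    refine (Finset.sum_le_sum fun i _ => h1 i).trans ?_
    simp
  obtain ⟨hc, hb⟩ := bdd_liminf_aux (fun n : ℕ => (1 / n : ℝ) * ∑ m ∈ Finset.range n, r m)
    (fun n => mul_nonneg (by positivity) (hs0 n)) (fun n => by
      rw [one_div, inv_mul_eq_div]; exact div_le_one_of_le₀ (hs1 n) (by positivity))
  refine le_of_forall_pos_sub_le fun ε hε => ?_
  refine le_liminf_of_le hc ?_
  have t1 : Tendsto (fun m : ℕ => γ - B / ((m : ℝ) ^ 2) + S (m ^ 2) / (m ^ 2 : ℕ) - 2 / (m : ℝ)) atTop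
      (nhds (γ - 0 + 0 - 0)) := by
    refine ((tendsto_const_nhds.sub ?_).add hS).sub ?_
    · exact tendsto_const_nhds.div_atTop ((tendsto_pow_atTop two_ne_zero).comp tendsto_natCast_atTop_atTop)
    · exact tendsto_const_nhds.div_atTop tendsto_natCast_atTop_atTop
  have t2 : ∀ᶠ m : ℕ in atTop, γ - ε < γ - B / ((m : ℝ) ^ 2) + S (m ^ 2) / (m ^ 2 : ℕ) - 2 / (m : ℝ) :=
    t1.eventually (lt_mem_nhds (by linarith))
  have t3 := tendsto_natSqrt.eventually ((t2.and (eventually_ge_atTop m0)).and (eventually_gt_atTop 0))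
  filter_upwards [t3] with n hn
  obtain ⟨⟨ha, hm0⟩, hpos⟩ := hn
  set m := Nat.sqrt n with hm
  have l1 : m ^ 2 ≤ n := Nat.sqrt_le' n
  have l2 : n ≤ m ^ 2 + 2 * m := by
    have := Nat.sqrt_le_add n
    rw [← hm] at this
    nlinarith
  have hmR : (0 : ℝ) < m := by exact_mod_cast hpos
  have l1R : (m : ℝ) ^ 2 ≤ n := by exact_mod_cast l1
  have l2R : (n : ℝ) ≤ (m : ℝ) ^ 2 + 2 * m := by exact_mod_cast l2
  have hm2 : (0 : ℝ) < (m : ℝ) ^ 2 := by positivity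
  have hn0 : (0 : ℝ) < n := lt_of_lt_of_le hm2 l1R
  have hh := h (m ^ 2) (hm0.trans (Nat.le_self_pow two_ne_zero m))
  have hmono : ∑ i ∈ Finset.range (m ^ 2), r i ≤ ∑ i ∈ Finset.range n, r i :=
    Finset.sum_le_sum_of_subset_of_nonneg (Finset.range_mono l1) fun i _ _ => h0 i
  set s := ∑ i ∈ Finset.range (m ^ 2), r i with hsdef
  have e1 : γ - B / ((m : ℝ) ^ 2) + S (m ^ 2) / (m ^ 2 : ℕ) ≤ s / (m : ℝ) ^ 2 := by
    rw [le_div_iff₀ hm2]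
    push_cast at hh ⊢
    refine le_trans (le_of_eq ?_) hh
    field_simp
  have hs1' : s ≤ (m : ℝ) ^ 2 := by have := hs1 (m ^ 2); push_cast at this; exact this
  have e2 : s / (m : ℝ) ^ 2 - 2 / m ≤ s / n := by
    rw [sub_le_iff_le_add, div_add_div _ _ hn0.ne' hmR.ne', div_le_div_iff₀ hm2 (by positivity)]
    have h3 : s * (n - (m : ℝ) ^ 2) ≤ (m : ℝ) ^ 2 * (2 * m) :=
      mul_le_mul hs1' (by linarith) (by linarith) (by positivity)
    have h4 : (m : ℝ) ^ 2 * (2 * m) * m ≤ n * 2 * m ^ 2 := by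
      nlinarith [mul_le_mul_of_nonneg_left l1R (by positivity : (0:ℝ) ≤ 2 * m ^ 2)]
    have h5 := mul_le_mul_of_nonneg_right h3 hmR.le
    nlinarith
  have e3 : s / n ≤ (1 / n : ℝ) * ∑ m ∈ Finset.range n, r m := by
    rw [one_div, inv_mul_eq_div]
    exact div_le_div_of_nonneg_right hmono hn0.le
  linarith

namespace POMDP
variable (Γ : POMDP)

lemma rew_nonneg (σ : Γ.Strategy) (ω m) : 0 ≤ Γ.rew σ ω m := Γ.g_nonneg _ _
lemma rew_le_one (σ : Γ.Strategy) (ω m) : Γ.rew σ ω m ≤ 1 := Γ.g_le_one _ _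

lemma avg_nonneg (σ : Γ.Strategy) (ω n) : 0 ≤ Γ.avg σ ω n :=
  mul_nonneg (by positivity) (Finset.sum_nonneg fun i _ => Γ.rew_nonneg _ _ _)

lemma avg_le_one (σ : Γ.Strategy) (ω n) : Γ.avg σ ω n ≤ 1 := by
  unfold avg
  rw [one_div, inv_mul_eq_div]
  refine div_le_one_of_le₀ ?_ (by positivity)
  refine (Finset.sum_le_sum fun i _ => Γ.rew_le_one _ _ i).trans ?_
  simp

lemma meas_rew (σ : Γ.Strategy) (k m) : Measurable (fun x => Γ.rew σ (k, x) m) :=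
  (Γ.measurable_traj' σ k m (fun z => Γ.g z.1 (σ z.2))).mono (sigG_le m) le_rfl

lemma meas_avg (σ : Γ.Strategy) (k n) : Measurable (fun x => Γ.avg σ (k, x) n) := by
  unfold avg
  exact (Finset.measurable_fun_sum _ fun m _ => Γ.meas_rew σ k m).const_mul _

lemma meas_liminf (σ : Γ.Strategy) (k) : Measurable (fun x => atTop.liminf (Γ.avg σ (k, x))) :=
  Measurable.liminf (Γ.meas_avg σ k)

lemma integrable_of_01 (f : ℝ → ℝ) (hf : Measurable f) (h : ∀ x, 0 ≤ f x ∧ f x ≤ 1) :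
    Integrable f mu0 :=
  Integrable.of_bound hf.aestronglyMeasurable 1 (ae_of_all _ fun x => by
    rw [Real.norm_eq_abs, abs_of_nonneg (h x).1]; exact (h x).2)

lemma int_liminf (σ : Γ.Strategy) (k) : Integrable (fun x => atTop.liminf (Γ.avg σ (k, x))) mu0 :=
  integrable_of_01 _ (Γ.meas_liminf σ k) fun x => liminf_mem _ (Γ.avg_nonneg _ _) (Γ.avg_le_one _ _)

lemma pay_eq (p1 : Γ.K → ℝ) (hp : ∀ k, 0 ≤ p1 k) (σ : Γ.Strategy) :
    Γ.pay p1 σ = ∑ k, p1 k * ∫ x, atTop.liminf (Γ.avg σ (k, x)) ∂mu0 :=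
  (Γ.env_integral p1 hp (fun ω => atTop.liminf (Γ.avg σ ω)) (Γ.int_liminf σ)).2

lemma pay_ge (p1 : Γ.K → ℝ) (hp : ∀ k, 0 ≤ p1 k) (σ : Γ.Strategy) (f : Γ.K → ℝ → ℝ)
    (hf : ∀ k, Integrable (f k) mu0)
    (h : ∀ k, ∀ᵐ x ∂mu0, f k x ≤ atTop.liminf (Γ.avg σ (k, x))) :
    ∑ k, p1 k * ∫ x, f k x ∂mu0 ≤ Γ.pay p1 σ := by
  rw [Γ.pay_eq p1 hp]
  exact Finset.sum_le_sum fun k _ => mul_le_mul_of_nonneg_left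
    (integral_mono_ae (hf k) (Γ.int_liminf σ k) (h k)) (hp k)

lemma pay_le_one (p1 : Γ.K → ℝ) (hp : IsBelief p1) (σ : Γ.Strategy) : Γ.pay p1 σ ≤ 1 := by
  rw [Γ.pay_eq p1 hp.1, ← hp.2]
  refine Finset.sum_le_sum fun k _ => ?_
  have : ∫ x, atTop.liminf (Γ.avg σ (k, x)) ∂mu0 ≤ ∫ x, (1 : ℝ) ∂mu0 :=
    integral_mono (Γ.int_liminf σ k) (integrable_const _) fun x =>
      (liminf_mem _ (Γ.avg_nonneg _ _) (Γ.avg_le_one _ _)).2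
  rw [integral_const, probReal_univ, one_smul] at this
  nlinarith [hp.1 k]

/-- Fatou -/
lemma fatou (p1 : Γ.K → ℝ) (hp : ∀ k, 0 ≤ p1 k) (σ : Γ.Strategy) : ∃ c : ℕ → ℝ,
    Tendsto c atTop (nhds (Γ.pay p1 σ)) ∧
    ∀ n, c n ≤ ∑ k, p1 k * ∫ x, Γ.avg σ (k, x) n ∂mu0 := by
  refine ⟨fun n => ∑ k, p1 k * ∫ x, min (Γ.avg σ (k, x) n) (atTop.liminf (Γ.avg σ (k, x))) ∂mu0, ?_, ?_⟩
  · rw [Γ.pay_eq p1 hp]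
    refine tendsto_finsetSum _ fun k _ => Tendsto.const_mul _ ?_
    refine tendsto_integral_of_dominated_convergence (fun _ => 1)
      (fun n => ((Γ.meas_avg σ k n).min (Γ.meas_liminf σ k)).aestronglyMeasurable)
      (integrable_const _) (fun n => ae_of_all _ fun x => ?_) (ae_of_all _ fun x => ?_)
    · have := liminf_mem _ (Γ.avg_nonneg σ (k, x)) (Γ.avg_le_one _ _)
      rw [Real.norm_eq_abs, abs_of_nonneg (le_min (Γ.avg_nonneg _ _ _) this.1)]
      exact (min_le_right _ _).trans this.2
    · obtain ⟨hc, hb⟩ := bdd_liminf_aux _ (Γ.avg_nonneg σ (k, x)) (Γ.avg_le_one _ _)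
      rw [tendsto_order]
      constructor
      · intro a ha
        filter_upwards [eventually_lt_of_lt_liminf ha hb] with n hn
        exact lt_min hn ha
      · intro a ha
        exact Eventually.of_forall fun n => lt_of_le_of_lt (min_le_right _ _) ha
  · intro n
    refine Finset.sum_le_sum fun k _ => mul_le_mul_of_nonneg_left ?_ (hp k)
    refine integral_mono ?_ (integrable_of_01 _ (Γ.meas_avg σ k n) fun x =>
      ⟨Γ.avg_nonneg _ _ _, Γ.avg_le_one _ _ _⟩) fun x => min_le_left _ _
    refine integrable_of_01 _ ((Γ.meas_avg σ k n).min (Γ.meas_liminf σ k)) fun x => ?_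
    have := liminf_mem _ (Γ.avg_nonneg σ (k, x)) (Γ.avg_le_one _ _)
    exact ⟨le_min (Γ.avg_nonneg _ _ _) this.1, (min_le_right _ _).trans this.2⟩

/-- A certificate that `τ` guarantees `γ` from state `k`. -/
def Guar (τ : Γ.Strategy) (k : Γ.K) (γ : ℝ) : Prop :=
  ∃ (I : Γ.Hist → Γ.K → Prop) (ψ : Γ.Hist → Γ.K → ℝ) (C : ℝ), I [] k ∧ (∀ h k, |ψ h k| ≤ C) ∧
    ∀ h k, I h k → (∀ y, 0 < Γ.q k (τ h) y → I (h ++ [(τ h, y.2)]) y.1) ∧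
      γ + ψ h k ≤ Γ.g k (τ h) + ∑ y, Γ.q k (τ h) y * ψ (h ++ [(τ h, y.2)]) y.1

lemma Guar.mono {τ : Γ.Strategy} {k : Γ.K} {γ γ' : ℝ} (h : Γ.Guar τ k γ) (hγ : γ' ≤ γ) :
    Γ.Guar τ k γ' := by
  obtain ⟨I, ψ, C, h1, h2, h3⟩ := h
  exact ⟨I, ψ, C, h1, h2, fun h k hk => ⟨(h3 h k hk).1, by linarith [(h3 h k hk).2]⟩⟩

lemma Guar.zero (τ : Γ.Strategy) (k : Γ.K) : Γ.Guar τ k 0 :=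
  ⟨fun _ _ => True, fun _ _ => 0, 0, trivial, by simp, fun h k _ => ⟨fun _ _ => trivial, by
    simpa using Γ.g_nonneg _ _⟩⟩

/-- play `σ0` for `m0` stages, then `τs h`. -/
def concat (σ0 : Γ.Strategy) (m0 : ℕ) (τs : Γ.Hist → Γ.Strategy) : Γ.Strategy := fun h =>
  if h.length < m0 then σ0 h else τs (h.take m0) (h.drop m0)

lemma traj_concat (σ0 : Γ.Strategy) (m0 : ℕ) (τs : Γ.Hist → Γ.Strategy) (ω : Γ.Env) (m : ℕ) (hm : m ≤ m0) :
    Γ.traj (Γ.concat σ0 m0 τs) ω m = Γ.traj σ0 ω m := by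
  induction m with
  | zero => rfl
  | succ m ih =>
    rw [traj_succ, traj_succ, ih (by omega)]
    have : Γ.concat σ0 m0 τs (Γ.traj σ0 ω m).2 = σ0 (Γ.traj σ0 ω m).2 := by
      unfold concat
      rw [if_pos (by rw [traj_length]; omega)]
    rw [this]

lemma concat_liminf (σ0 : Γ.Strategy) (m0 : ℕ) (τs : Γ.Hist → Γ.Strategy) (R : Γ.K → Γ.Hist → ℝ)
    (hR : ∀ k h, Γ.Guar (τs h) k (R k h)) (k : Γ.K) :
    ∀ᵐ x ∂mu0, R (Γ.traj σ0 (k, x) m0).1 (Γ.traj σ0 (k, x) m0).2 ≤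
      atTop.liminf (Γ.avg (Γ.concat σ0 m0 τs) (k, x)) := by
  set τ := Γ.concat σ0 m0 τs with hτ
  have key : ∀ z0 : Γ.K × Γ.Hist, ∀ᵐ x ∂mu0, Γ.traj σ0 (k, x) m0 = z0 →
      R z0.1 z0.2 ≤ atTop.liminf (Γ.avg τ (k, x)) := by
    rintro ⟨k0, h0⟩
    obtain ⟨I, ψ, C, hI, hC, hG⟩ := hR k0 h0
    set Φ : Γ.K × Γ.Hist → ℝ := fun z => ψ (z.2.drop m0) z.1 with hΦ
    filter_upwards [Γ.lln τ Φ C (fun z => hC _ _) k, Γ.ae_pos τ k] with x hx hpos htr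
    have hlen : h0.length = m0 := by
      have := Γ.traj_length σ0 (k, x) m0
      rw [htr] at this; exact this
    rw [← Γ.traj_concat σ0 m0 τs (k, x) m0 le_rfl] at htr
    have inv : ∀ j, ∃ h', (Γ.traj τ (k, x) (m0 + j)).2 = h0 ++ h' ∧ I h' (Γ.traj τ (k, x) (m0 + j)).1 := by
      intro j
      induction j with
      | zero => exact ⟨[], by rw [add_zero, htr]; simp, by rw [add_zero, htr]; exact hI⟩
      | succ j ih =>
        obtain ⟨h', e, hi⟩ := ih
        obtain ⟨y, hy, hys⟩ := hpos (m0 + j)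
        have ea : τ (Γ.traj τ (k, x) (m0 + j)).2 = τs h0 h' := by
          rw [e, hτ, concat, if_neg (by simp [hlen]), List.take_left' hlen, List.drop_left' hlen]
        rw [ea] at hy
        refine ⟨h' ++ [(τs h0 h', y.2)], ?_, ?_⟩
        · rw [← add_assoc, hys, ea, e]; simp
        · rw [← add_assoc, hys]; exact (hG _ _ hi).1 y hy
    have hstep : ∀ j, R k0 h0 + Φ (Γ.traj τ (k, x) (m0 + j)) - Φ (Γ.traj τ (k, x) (m0 + j + 1))
        + Γ.DD τ Φ k (m0 + j) x ≤ Γ.rew τ (k, x) (m0 + j) := by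
      intro j
      obtain ⟨h', e, hi⟩ := inv j
      have ea : τ (Γ.traj τ (k, x) (m0 + j)).2 = τs h0 h' := by
        rw [e, hτ, concat, if_neg (by simp [hlen]), List.take_left' hlen, List.drop_left' hlen]
      have h2 := (hG _ _ hi).2
      have e1 : Φ (Γ.traj τ (k, x) (m0 + j)) = ψ h' (Γ.traj τ (k, x) (m0 + j)).1 := by
        simp only [hΦ]; rw [e, List.drop_left' hlen]
      have e2 : Γ.rew τ (k, x) (m0 + j) = Γ.g (Γ.traj τ (k, x) (m0 + j)).1 (τs h0 h') := by
        simp only [rew, act, state, hist]; rw [ea]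
      have e3 : Γ.Pop τ Φ (Γ.traj τ (k, x) (m0 + j)) = ∑ y, Γ.q (Γ.traj τ (k, x) (m0 + j)).1 (τs h0 h') y *
          ψ (h' ++ [(τs h0 h', y.2)]) y.1 := by
        simp only [Pop, hΦ]; rw [ea, e]
        simp only [List.append_assoc, List.drop_left' hlen]
      rw [DD, e3, e1, e2]
      linarith
    have hsum : ∀ j : ℕ, j * R k0 h0 + Φ (Γ.traj τ (k, x) m0) - Φ (Γ.traj τ (k, x) (m0 + j))
        + Γ.SD τ Φ k (m0 + j) x - Γ.SD τ Φ k m0 x ≤ ∑ m ∈ Finset.range (m0 + j), Γ.rew τ (k, x) m := by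
      intro j
      induction j with
      | zero =>
        simp only [add_zero]
        have : 0 ≤ ∑ m ∈ Finset.range m0, Γ.rew τ (k, x) m :=
          Finset.sum_nonneg fun i _ => Γ.rew_nonneg _ _ _
        simp; linarith
      | succ j ih =>
        rw [← add_assoc, Finset.sum_range_succ]
        have : Γ.SD τ Φ k (m0 + j + 1) x = Γ.SD τ Φ k (m0 + j) x + Γ.DD τ Φ k (m0 + j) x := by
          simp [SD, Finset.sum_range_succ]
        rw [this]
        have := hstep j
        push_cast
        linarith
    refine real_liminf (Γ.rew τ (k, x)) (Γ.rew_nonneg _ _) (Γ.rew_le_one _ _)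
      (fun n => Γ.SD τ Φ k n x) (R k0 h0) (m0 * R k0 h0 + 2 * C + Γ.SD τ Φ k m0 x) m0 hx ?_
    intro n hn
    obtain ⟨j, rfl⟩ := Nat.exists_eq_add_of_le hn
    refine le_trans ?_ (hsum j)
    have b1 := abs_le.1 (hC ((Γ.traj τ (k, x) m0).2.drop m0) (Γ.traj τ (k, x) m0).1)
    have b2 := abs_le.1 (hC ((Γ.traj τ (k, x) (m0 + j)).2.drop m0) (Γ.traj τ (k, x) (m0 + j)).1)
    simp only [hΦ]
    push_cast
    linarith [b1.1, b2.2]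
  filter_upwards [ae_all_iff.2 key] with x hx
  exact hx _ rfl

lemma concat_pay (p1 : Γ.K → ℝ) (hp : ∀ k, 0 ≤ p1 k) (σ0 : Γ.Strategy) (m0 : ℕ) (τs : Γ.Hist → Γ.Strategy)
    (R : Γ.K → Γ.Hist → ℝ) (hR : ∀ k h, Γ.Guar (τs h) k (R k h)) (hR1 : ∀ k h, 0 ≤ R k h ∧ R k h ≤ 1) :
    ∑ k, p1 k * ∫ x, R (Γ.traj σ0 (k, x) m0).1 (Γ.traj σ0 (k, x) m0).2 ∂mu0 ≤
      Γ.pay p1 (Γ.concat σ0 m0 τs) := by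
  refine Γ.pay_ge p1 hp _ (fun k x => R (Γ.traj σ0 (k, x) m0).1 (Γ.traj σ0 (k, x) m0).2) (fun k => ?_)
    (Γ.concat_liminf σ0 m0 τs R hR)
  exact integrable_of_01 _ ((Γ.measurable_traj' σ0 k m0 (fun z => R z.1 z.2)).mono (sigG_le _) le_rfl)
    fun x => hR1 _ _

end POMDP


open ProbabilityTheory

namespace POMDP
variable (Γ : POMDP)

lemma fm_of_finite {M : Type} [Finite M] (i0 : M) (ac : M → Γ.A) (up : M → Γ.A × Γ.S → M)
    (σ : Γ.Strategy) (h : ∀ h : Γ.Hist, σ h = ac (h.foldl up i0)) : Γ.FiniteMemory σ := by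
  obtain ⟨n, ⟨e⟩⟩ := Finite.exists_equiv_fin M
  refine ⟨n, e i0, fun i => ac (e.symm i), fun i y => e (up (e.symm i) y), fun l => ?_⟩
  rw [h]
  have : ∀ (l : Γ.Hist) (i : M), l.foldl (fun i y => e (up (e.symm i) y)) (e i) = e (l.foldl up i) := by
    intro l
    induction l with
    | nil => intro i; rfl
    | cons y l ih => intro i; simp only [List.foldl_cons, Equiv.symm_apply_apply]; exact ih _
  rw [this]; simp only [Equiv.symm_apply_apply]

lemma concat_fm (σ0 : Γ.Strategy) (m0 : ℕ) (τs : Γ.Hist → Γ.Strategy)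
    (hτ : ∀ h, Γ.FiniteMemory (τs h)) : Γ.FiniteMemory (Γ.concat σ0 m0 τs) := by
  choose n ini ac up hfm using hτ
  have hfin : Finite {h : Γ.Hist // h.length ≤ m0} :=
    (List.finite_length_le (Γ.A × Γ.S) m0).to_subtype
  let M := Σ h0 : {h : Γ.Hist // h.length ≤ m0}, Fin (n h0.1)
  let upd : M → Γ.A × Γ.S → M := fun s y =>
    if hl : s.1.1.length < m0 then ⟨⟨s.1.1 ++ [y], by simp; omega⟩, ini _⟩
    else ⟨s.1, up s.1.1 s.2 y⟩
  let act : M → Γ.A := fun s => if s.1.1.length < m0 then σ0 s.1.1 else ac s.1.1 s.2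
  have h1 : ∀ (h : Γ.Hist) (hl : h.length ≤ m0), h.foldl upd ⟨⟨[], by simp⟩, ini _⟩ = ⟨⟨h, hl⟩, ini _⟩ := by
    intro h
    induction h using List.reverseRecOn with
    | nil => intro _; rfl
    | append_singleton l y ih =>
      intro hl
      simp only [List.length_append, List.length_singleton] at hl
      rw [List.foldl_append, ih (by omega)]
      simp only [List.foldl_cons, List.foldl_nil, upd]
      rw [dif_pos (by omega)]
  have h2 : ∀ (h' : Γ.Hist) (h0 : Γ.Hist) (hl : h0.length ≤ m0) (_ : h0.length = m0) (j : Fin (n h0)),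
      h'.foldl upd ⟨⟨h0, hl⟩, j⟩ = ⟨⟨h0, hl⟩, h'.foldl (up h0) j⟩ := by
    intro h'
    induction h' with
    | nil => intros; rfl
    | cons y l ih =>
      intro h0 hl hl' j
      simp only [List.foldl_cons]
      have : upd ⟨⟨h0, hl⟩, j⟩ y = ⟨⟨h0, hl⟩, up h0 j y⟩ := by
        simp only [upd]; rw [dif_neg (by omega)]
      rw [this, ih _ _ hl']
  refine Γ.fm_of_finite (M := M) ⟨⟨[], by simp⟩, ini _⟩ act upd _ fun h => ?_
  unfold concat
  split_ifs with hl
  · rw [h1 h hl.le]; simp only [act]; rw [if_pos hl]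
  · have hlt : (h.take m0).length = m0 := by simp; omega
    conv_rhs => rw [← List.take_append_drop m0 h]
    rw [List.foldl_append, h1 _ hlt.le, h2 _ _ _ hlt]
    simp only [act]
    rw [if_neg (by omega), hfm]

lemma fm_countable : {τ : Γ.Strategy | Γ.FiniteMemory τ}.Countable := by
  let f : (Σ n : ℕ, Fin n × (Fin n → Γ.A) × (Fin n → Γ.A × Γ.S → Fin n)) → Γ.Strategy :=
    fun p h => p.2.2.1 (h.foldl p.2.2.2 p.2.1)
  refine (Set.countable_range f).mono ?_
  rintro τ ⟨n, i, a, u, h⟩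
  exact ⟨⟨n, i, a, u⟩, (funext h).symm⟩

lemma fm_const (a : Γ.A) : Γ.FiniteMemory (fun _ => a) :=
  Γ.fm_of_finite (M := Unit) () (fun _ => a) (fun _ _ => ()) _ fun _ => rfl

/-- continuation strategy -/
def shift (σ : Γ.Strategy) (h : Γ.Hist) : Γ.Strategy := fun h' => σ (h ++ h')

lemma shift_shift (σ : Γ.Strategy) (h h' : Γ.Hist) :
    Γ.shift (Γ.shift σ h) h' = Γ.shift σ (h ++ h') := by
  funext l; simp [shift]

lemma shift_nil (σ : Γ.Strategy) : Γ.shift σ [] = σ := rfl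

/-- continuation after one stage -/
def nextS (σ : Γ.Strategy) (s : Γ.S) : Γ.Strategy := Γ.shift σ [(σ [], s)]

/-- expected total reward over `n` stages -/
noncomputable def UU : ℕ → Γ.K → Γ.Strategy → ℝ
  | 0, _, _ => 0
  | n + 1, k, σ => Γ.g k (σ []) + ∑ y, Γ.q k (σ []) y * UU n y.1 (Γ.nextS σ y.2)

lemma UU_succ (n k σ) : Γ.UU (n + 1) k σ =
    Γ.g k (σ []) + ∑ y, Γ.q k (σ []) y * Γ.UU n y.1 (Γ.nextS σ y.2) := rfl

lemma UU_bound (n k σ) : 0 ≤ Γ.UU n k σ ∧ Γ.UU n k σ ≤ n := by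
  induction n generalizing k σ with
  | zero => simp [UU]
  | succ n ih =>
    rw [UU_succ]
    constructor
    · exact add_nonneg (Γ.g_nonneg _ _) (Finset.sum_nonneg fun y _ => mul_nonneg (Γ.q_nonneg _ _ _) (ih _ _).1)
    · have : ∑ y, Γ.q k (σ []) y * Γ.UU n y.1 (Γ.nextS σ y.2) ≤ ∑ y, Γ.q k (σ []) y * n :=
        Finset.sum_le_sum fun y _ => mul_le_mul_of_nonneg_left (ih _ _).2 (Γ.q_nonneg _ _ _)
      rw [← Finset.sum_mul, Γ.q_sum, one_mul] at this
      push_cast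
      linarith [Γ.g_le_one k (σ [])]

/-- advance of a super-support -/
def advS (B : Γ.K → Γ.K → Prop) (z : Γ.A × Γ.S) : Γ.K → Γ.K → Prop :=
  fun k0 k' => ∃ k, B k0 k ∧ 0 < Γ.q k z.1 (k', z.2)

/-- iterated advance -/
def advL (B : Γ.K → Γ.K → Prop) (h : Γ.Hist) : Γ.K → Γ.K → Prop := h.foldl Γ.advS B

theorem partD (G : Set (Γ.K × Γ.Strategy)) (gb : Γ.K × Γ.Strategy → ℝ) (N : ℕ → ℕ)
    (hN : Tendsto N atTop atTop)
    (hU : ∀ x ∈ G, Tendsto (fun j => Γ.UU (N j) x.1 x.2 / N j) atTop (nhds (gb x)))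
    (hG : ∀ k σ, (k, σ) ∈ G → ∀ y, 0 < Γ.q k (σ []) y →
      (y.1, Γ.nextS σ y.2) ∈ G ∧ gb (y.1, Γ.nextS σ y.2) = gb (k, σ))
    (σ : Γ.Strategy) (ε : ℝ) (hε : 0 < ε) :
    ∃ τ, Γ.FiniteMemory τ ∧ ∀ k, (k, σ) ∈ G → Γ.Guar τ k (gb (k, σ) - ε) := by
  classical
  let J : (Γ.K → Γ.K → Prop) → Γ.Strategy → Prop := fun B σ' =>
    ∀ k0 k, B k0 k → (k, σ') ∈ G ∧ gb (k, σ') = gb (k0, σ)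
  let rep : (Γ.K → Γ.K → Prop) → Γ.Strategy := fun B => if h : ∃ σ', J B σ' then h.choose else σ
  have hrep : ∀ B σ', J B σ' → J B (rep B) := by
    intro B σ' h
    have hex : ∃ σ', J B σ' := ⟨σ', h⟩
    simp only [rep]; rw [dif_pos hex]; exact hex.choose_spec
  have hev : ∀ᶠ j in atTop, (∀ (B : Γ.K → Γ.K → Prop) (k0 k : Γ.K), J B (rep B) → B k0 k →
      gb (k0, σ) - ε < Γ.UU (N j) k (rep B) / N j) ∧ 0 < N j := by
    refine Eventually.and ?_ (hN.eventually (eventually_gt_atTop 0))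
    rw [eventually_all]; intro B
    rw [eventually_all]; intro k0
    rw [eventually_all]; intro k
    by_cases h : J B (rep B) ∧ B k0 k
    · have := h.1 k0 k h.2
      have h2 := hU _ this.1
      rw [this.2] at h2
      filter_upwards [h2.eventually (lt_mem_nhds (show gb (k0, σ) - ε < gb (k0, σ) by linarith))] with j hj _ _
      exact hj
    · exact Eventually.of_forall fun j h1 h2 => absurd ⟨h1, h2⟩ h
  obtain ⟨j, hj, hNpos⟩ := hev.exists
  set n := N j with hn
  have hfin : Finite {h : Γ.Hist // h.length < n} := (List.finite_length_lt (Γ.A × Γ.S) n).to_subtype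
  let upd : (Γ.K → Γ.K → Prop) × {h : Γ.Hist // h.length < n} → Γ.A × Γ.S →
      (Γ.K → Γ.K → Prop) × {h : Γ.Hist // h.length < n} := fun s y =>
    if hl : (s.2.1 ++ [y]).length < n then (s.1, ⟨s.2.1 ++ [y], hl⟩)
    else (Γ.advL s.1 (s.2.1 ++ [y]), ⟨[], hNpos⟩)
  let B0 : Γ.K → Γ.K → Prop := fun k0 k => k = k0 ∧ (k0, σ) ∈ G
  let ini : (Γ.K → Γ.K → Prop) × {h : Γ.Hist // h.length < n} := (B0, ⟨[], hNpos⟩)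
  let act : (Γ.K → Γ.K → Prop) × {h : Γ.Hist // h.length < n} → Γ.A := fun s => rep s.1 s.2.1
  let mem : Γ.Hist → (Γ.K → Γ.K → Prop) × {h : Γ.Hist // h.length < n} := fun h => h.foldl upd ini
  have hmem : ∀ h y, mem (h ++ [y]) = upd (mem h) y := fun h y => by simp [mem, List.foldl_append]
  let τ : Γ.Strategy := fun h => act (mem h)
  refine ⟨τ, Γ.fm_of_finite ini act upd τ fun _ => rfl, fun k0 hk0 => ?_⟩
  set γ := gb (k0, σ) - ε with hγ
  let I' : (Γ.K → Γ.K → Prop) × {h : Γ.Hist // h.length < n} → Γ.K → Prop := fun s k =>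
    J s.1 (rep s.1) ∧ J (Γ.advL s.1 s.2.1) (Γ.shift (rep s.1) s.2.1) ∧ Γ.advL s.1 s.2.1 k0 k
  let ψ' : (Γ.K → Γ.K → Prop) × {h : Γ.Hist // h.length < n} → Γ.K → ℝ := fun s k =>
    Γ.UU (n - s.2.1.length) k (Γ.shift (rep s.1) s.2.1) - γ * (n - s.2.1.length : ℕ)
  have main : ∀ s k, I' s k → (∀ y, 0 < Γ.q k (act s) y → I' (upd s (act s, y.2)) y.1) ∧
      γ + ψ' s k ≤ Γ.g k (act s) + ∑ y, Γ.q k (act s) y * ψ' (upd s (act s, y.2)) y.1 := by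
    rintro ⟨B, ⟨h, hl⟩⟩ k ⟨hJ1, hJ2, hk⟩
    simp only at hJ1 hJ2 hk
    have hact : act (B, ⟨h, hl⟩) = Γ.shift (rep B) h [] := by simp [act, shift]
    set a := act (B, ⟨h, hl⟩) with ha
    have hnx : ∀ s, Γ.nextS (Γ.shift (rep B) h) s = Γ.shift (rep B) (h ++ [(a, s)]) := by
      intro s
      rw [nextS, shift_shift, ← hact]
    have hadv : ∀ y, Γ.advL B (h ++ [y]) = Γ.advS (Γ.advL B h) y := fun y => by
      simp [advL, List.foldl_append]
    have hJn : ∀ s, J (Γ.advL B (h ++ [(a, s)])) (Γ.shift (rep B) (h ++ [(a, s)])) := by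
      intro s k0' k'
      rw [hadv]
      rintro ⟨k1, hk1, hq⟩
      obtain ⟨g1, g2⟩ := hJ2 k0' k1 hk1
      have := hG k1 _ g1 (k', s) (by rw [← hact]; exact hq)
      rw [hnx] at this
      exact ⟨this.1, this.2.trans g2⟩
    have hIy : ∀ y, 0 < Γ.q k a y → I' (upd (B, ⟨h, hl⟩) (a, y.2)) y.1 := by
      intro y hy
      have hB : Γ.advL B (h ++ [(a, y.2)]) k0 y.1 := by rw [hadv]; exact ⟨k, hk, hy⟩
      simp only [upd]
      split_ifs with hc
      · exact ⟨hJ1, hJn _, hB⟩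
      · have := hrep _ _ (hJn y.2)
        exact ⟨this, this, hB⟩
    refine ⟨hIy, ?_⟩
    obtain ⟨r, hr⟩ : ∃ r, n - h.length = r + 1 := ⟨n - h.length - 1, by omega⟩
    have e1 : ψ' (B, ⟨h, hl⟩) k = Γ.g k a + ∑ y, Γ.q k a y * Γ.UU r y.1 (Γ.shift (rep B) (h ++ [(a, y.2)]))
        - γ * (r + 1 : ℕ) := by
      simp only [ψ']
      rw [hr, UU_succ, ← hact]
      simp only [hnx]
    have e2 : ∀ y, Γ.q k a y * (Γ.UU r y.1 (Γ.shift (rep B) (h ++ [(a, y.2)])) - γ * r) ≤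
        Γ.q k a y * ψ' (upd (B, ⟨h, hl⟩) (a, y.2)) y.1 := by
      intro y
      rcases (Γ.q_nonneg k a y).eq_or_lt with h0 | hpos
      · rw [← h0]; simp
      refine mul_le_mul_of_nonneg_left ?_ hpos.le
      have hI := hIy y hpos
      by_cases hc : (h ++ [(a, y.2)]).length < n
      · have eu : upd (B, ⟨h, hl⟩) (a, y.2) = (B, ⟨h ++ [(a, y.2)], hc⟩) := by
          simp only [upd]; rw [dif_pos hc]
        have er : n - (h ++ [(a, y.2)]).length = r := by simp; omega
        rw [eu]; simp only [ψ']; rw [er]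
      · have eu : upd (B, ⟨h, hl⟩) (a, y.2) = (Γ.advL B (h ++ [(a, y.2)]), ⟨[], hNpos⟩) := by
          simp only [upd]; rw [dif_neg hc]
        have er : r = 0 := by simp at hc; omega
        rw [eu] at hI ⊢
        have h3 := hj _ k0 y.1 hI.1 hI.2.2
        rw [lt_div_iff₀ (by exact_mod_cast hNpos)] at h3
        simp only [ψ', er, UU, List.length_nil, Nat.sub_zero, shift_nil]
        push_cast
        linarith
    have e3 := Finset.sum_le_sum fun y (_ : y ∈ Finset.univ) => e2 y
    simp only [mul_sub, Finset.sum_sub_distrib] at e3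
    rw [← Finset.sum_mul, Γ.q_sum] at e3
    rw [e1]
    push_cast
    simp only [mul_sub] at *
    linarith
  refine ⟨fun h k => I' (mem h) k, fun h k => ψ' (mem h) k, n + |γ| * n, ?_, ?_, ?_⟩
  · have hJ0 : J B0 σ := by
      rintro k1 k ⟨rfl, h⟩
      exact ⟨h, rfl⟩
    have := hrep _ _ hJ0
    exact ⟨this, this, rfl, hk0⟩
  · intro h k
    simp only [ψ']
    have h1 := Γ.UU_bound (n - (mem h).2.1.length) k (Γ.shift (rep (mem h).1) (mem h).2.1)
    have h2 : ((n - (mem h).2.1.length : ℕ) : ℝ) ≤ n := by exact_mod_cast Nat.sub_le _ _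
    refine (abs_sub _ _).trans ?_
    rw [abs_of_nonneg h1.1, abs_mul, Nat.abs_cast]
    gcongr
    exact h1.2.trans h2
  · intro h k hI
    simp only [hmem]
    exact main (mem h) k hI

end POMDP


open ProbabilityTheory

namespace POMDP
variable (Γ : POMDP)

/-- expectation at stage `m` -/
noncomputable def EE (p1 : Γ.K → ℝ) (σ : Γ.Strategy) (m : ℕ) (φ : Γ.K × Γ.Hist → ℝ) : ℝ :=
  ∑ k, p1 k * ∫ x, φ (Γ.traj σ (k, x) m) ∂mu0

open Classical in
/-- weights at stage `m` -/
noncomputable def ww (p1 : Γ.K → ℝ) (σ : Γ.Strategy) (m : ℕ) (z : Γ.K × Γ.Hist) : ℝ :=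
  Γ.EE p1 σ m (fun z' => if z' = z then 1 else 0)

lemma ww_nonneg (p1 : Γ.K → ℝ) (hp : ∀ k, 0 ≤ p1 k) (σ m z) : 0 ≤ Γ.ww p1 σ m z := by
  unfold ww EE
  refine Finset.sum_nonneg fun k _ => mul_nonneg (hp k) (integral_nonneg fun x => ?_)
  simp only [Pi.zero_apply]
  split_ifs <;> norm_num

lemma EE_eq (p1 : Γ.K → ℝ) (σ m) (φ : Γ.K × Γ.Hist → ℝ) :
    Γ.EE p1 σ m φ = ∑ z ∈ Γ.VV m, Γ.ww p1 σ m z * φ z := by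
  classical
  have h1 : ∀ k x, φ (Γ.traj σ (k, x) m) =
      ∑ z ∈ Γ.VV m, (if Γ.traj σ (k, x) m = z then 1 else 0) * φ z := by
    intro k x
    rw [Finset.sum_eq_single (Γ.traj σ (k, x) m) (fun z _ hz => by simp [hz.symm])
      (fun h => absurd (Γ.traj_mem_VV σ _ m) h)]
    simp
  have hi : ∀ k z, Integrable (fun x => (if Γ.traj σ (k, x) m = z then (1 : ℝ) else 0) * φ z) mu0 := by
    intro k z
    refine Integrable.mul_const (integrable_of_01 _ ?_ fun x => ?_) _
    · exact (Γ.measurable_traj' σ k m (fun z' => if z' = z then (1 : ℝ) else 0)).mono (sigG_le m) le_rfl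
    · split_ifs <;> norm_num
  unfold EE
  simp_rw [h1]
  simp only [ww, EE, Finset.sum_mul]
  rw [Finset.sum_comm]
  refine Finset.sum_congr rfl fun k _ => ?_
  rw [integral_finsetSum _ fun z _ => hi k z, Finset.mul_sum]
  refine Finset.sum_congr rfl fun z _ => ?_
  rw [integral_mul_const, mul_assoc]

lemma ww_sum (p1 : Γ.K → ℝ) (hp : IsBelief p1) (σ m) : ∑ z ∈ Γ.VV m, Γ.ww p1 σ m z = 1 := by
  have := Γ.EE_eq p1 σ m (fun _ => 1)
  simp only [mul_one] at this
  rw [← this, EE]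
  simp [hp.2]

lemma EE_mono (p1 : Γ.K → ℝ) (hp : ∀ k, 0 ≤ p1 k) (σ m) (φ ψ : Γ.K × Γ.Hist → ℝ) (h : ∀ z, φ z ≤ ψ z) :
    Γ.EE p1 σ m φ ≤ Γ.EE p1 σ m ψ := by
  rw [EE_eq, EE_eq]
  exact Finset.sum_le_sum fun z _ => mul_le_mul_of_nonneg_left (h z) (Γ.ww_nonneg p1 hp σ m z)

lemma EE_const (p1 : Γ.K → ℝ) (hp : IsBelief p1) (σ m) (c : ℝ) : Γ.EE p1 σ m (fun _ => c) = c := by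
  rw [EE_eq, ← Finset.sum_mul, Γ.ww_sum p1 hp, one_mul]

lemma EE_step (p1 : Γ.K → ℝ) (σ m) (φ : Γ.K × Γ.Hist → ℝ) :
    Γ.EE p1 σ (m + 1) φ = Γ.EE p1 σ m (Γ.Pop σ φ) := by
  unfold EE
  refine Finset.sum_congr rfl fun k _ => ?_
  have := Γ.step_k σ k m (fun _ => 1) (@measurable_const _ _ _ (sigG m) _) 1 (by simp) φ
  simp only [one_mul] at this
  rw [this]

lemma EE_avg (p1 : Γ.K → ℝ) (σ : Γ.Strategy) (n : ℕ) : ∑ k, p1 k * ∫ x, Γ.avg σ (k, x) n ∂mu0 =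
    (1 / n : ℝ) * ∑ m ∈ Finset.range n, Γ.EE p1 σ m (fun z => Γ.g z.1 (σ z.2)) := by
  unfold avg EE
  rw [Finset.sum_comm, Finset.mul_sum]
  refine Finset.sum_congr rfl fun k _ => ?_
  rw [integral_const_mul, integral_finsetSum _ fun m _ => integrable_of_01 _ (Γ.meas_rew σ k m)
    fun x => ⟨Γ.rew_nonneg _ _ _, Γ.rew_le_one _ _ _⟩, ← Finset.mul_sum]
  simp only [rew, act, state, hist]
  ring

/-- embedding -/
def emb (σ0 : Γ.Strategy) (z : Γ.K × Γ.Hist) : Γ.K × Γ.Strategy := (z.1, Γ.shift σ0 z.2)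

/-- Cesaro average occupation measure -/
noncomputable def cs (p1 : Γ.K → ℝ) (σ0 : Γ.Strategy) (n : ℕ) : Measure (Γ.K × Γ.Strategy) :=
  ∑ m ∈ Finset.range (n + 1), ∑ z ∈ Γ.VV m,
    ENNReal.ofReal (Γ.ww p1 σ0 m z / (n + 1)) • Measure.dirac (Γ.emb σ0 z)

lemma cs_prob (p1 : Γ.K → ℝ) (hp : IsBelief p1) (σ0 : Γ.Strategy) (n : ℕ) :
    IsProbabilityMeasure (Γ.cs p1 σ0 n) := by
  constructor
  unfold cs
  simp only [Measure.finsetSum_apply, Measure.smul_apply, measure_univ, smul_eq_mul, mul_one]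
  have h0 : ∀ m z, 0 ≤ Γ.ww p1 σ0 m z / ((n : ℝ) + 1) := fun m z =>
    div_nonneg (Γ.ww_nonneg p1 hp.1 _ _ _) (by positivity)
  have : ∀ m, ∑ z ∈ Γ.VV m, ENNReal.ofReal (Γ.ww p1 σ0 m z / ((n : ℝ) + 1)) = ENNReal.ofReal (1 / ((n : ℝ) + 1)) := by
    intro m
    rw [← ENNReal.ofReal_sum_of_nonneg fun z _ => h0 m z, ← Finset.sum_div, Γ.ww_sum p1 hp]
  simp only [this]
  rw [← ENNReal.ofReal_sum_of_nonneg fun z _ => by positivity]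
  rw [Finset.sum_const, Finset.card_range, nsmul_eq_mul]
  push_cast
  rw [mul_one_div_cancel (by positivity), ENNReal.ofReal_one]

lemma cs_int (p1 : Γ.K → ℝ) (hp : IsBelief p1) (σ0 : Γ.Strategy) (n : ℕ) (φ : Γ.K × Γ.Strategy → ℝ) :
    ∫ x, φ x ∂(Γ.cs p1 σ0 n) = (1 / ((n : ℝ) + 1)) *
      ∑ m ∈ Finset.range (n + 1), Γ.EE p1 σ0 m (fun z => φ (Γ.emb σ0 z)) := by
  unfold cs
  have hi : ∀ m z, Integrable φ (ENNReal.ofReal (Γ.ww p1 σ0 m z / ((n : ℝ) + 1)) • Measure.dirac (Γ.emb σ0 z)) :=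
    fun m z => (integrable_dirac (by simp)).smul_measure ENNReal.ofReal_ne_top
  rw [integral_finsetSum_measure fun m _ => integrable_finsetSum_measure.2 fun z _ => hi m z, Finset.mul_sum]
  refine Finset.sum_congr rfl fun m _ => ?_
  rw [integral_finsetSum_measure fun z _ => hi m z, EE_eq, Finset.mul_sum]
  refine Finset.sum_congr rfl fun z _ => ?_
  rw [integral_smul_measure, integral_dirac, ENNReal.toReal_ofReal
    (div_nonneg (Γ.ww_nonneg p1 hp.1 _ _ _) (by positivity)), smul_eq_mul]
  ring

/-- the transition operator on functions on states times strategies -/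
noncomputable def PP (φ : Γ.K × Γ.Strategy → ℝ) (x : Γ.K × Γ.Strategy) : ℝ :=
  ∑ y, Γ.q x.1 (x.2 []) y * φ (y.1, Γ.nextS x.2 y.2)

lemma Pop_emb (σ0 : Γ.Strategy) (φ : Γ.K × Γ.Strategy → ℝ) (z) :
    Γ.Pop σ0 (fun z => φ (Γ.emb σ0 z)) z = Γ.PP φ (Γ.emb σ0 z) := by
  unfold Pop PP
  have h1 : (Γ.emb σ0 z).2 [] = σ0 z.2 := by simp [emb, shift]
  rw [h1]
  refine Finset.sum_congr rfl fun y _ => ?_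
  congr 2
  simp only [emb, nextS, shift_shift]
  simp [shift]

lemma continuous_nextS (s : Γ.S) : Continuous (fun σ : Γ.Strategy => Γ.nextS σ s) := by
  refine continuous_pi fun h => ?_
  have h1 : Continuous (fun p : Γ.A × Γ.Strategy => p.2 ((p.1, s) :: h)) :=
    continuous_prod_of_discrete_left.2 fun a =>
      show Continuous (fun p : Γ.Strategy => p ((a, s) :: h)) from continuous_apply _
  have h2 : Continuous (fun σ : Γ.Strategy => ((σ [], σ) : Γ.A × Γ.Strategy)) :=
    (continuous_apply _).prodMk continuous_id
  exact h1.comp h2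

lemma continuous_stepX (y : Γ.K × Γ.S) :
    Continuous (fun x : Γ.K × Γ.Strategy => ((y.1, Γ.nextS x.2 y.2) : Γ.K × Γ.Strategy)) :=
  continuous_const.prodMk ((Γ.continuous_nextS y.2).comp continuous_snd)

lemma continuous_KA {β : Type*} [TopologicalSpace β] (f : Γ.K → Γ.A → β) :
    Continuous (fun x : Γ.K × Γ.Strategy => f x.1 (x.2 [])) := by
  have h1 : Continuous (fun x : Γ.K × Γ.Strategy => ((x.1, x.2 []) : Γ.K × Γ.A)) :=
    continuous_fst.prodMk ((continuous_apply _).comp continuous_snd)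
  exact (continuous_of_discreteTopology (f := fun p : Γ.K × Γ.A => f p.1 p.2)).comp h1

lemma continuous_PP (φ : Γ.K × Γ.Strategy → ℝ) (hφ : Continuous φ) : Continuous (Γ.PP φ) := by
  unfold PP
  exact continuous_finsetSum _ fun y _ => (Γ.continuous_KA (fun k a => Γ.q k a y)).mul
    (hφ.comp (Γ.continuous_stepX y))

lemma continuous_UU (n : ℕ) : Continuous (fun x : Γ.K × Γ.Strategy => Γ.UU n x.1 x.2) := by
  induction n with
  | zero => exact continuous_const
  | succ n ih => exact (Γ.continuous_KA Γ.g).add (Γ.continuous_PP _ ih)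

lemma exists_bound (φ : Γ.K × Γ.Strategy → ℝ) (hφ : Continuous φ) : ∃ C, ∀ x, |φ x| ≤ C := by
  obtain ⟨C, hC⟩ := isCompact_univ.exists_bound_of_continuousOn hφ.continuousOn
  exact ⟨C, fun x => hC x (Set.mem_univ x)⟩

theorem partE1 (p1 : Γ.K → ℝ) (hp : IsBelief p1) (σ0 : Γ.Strategy) :
    ∃ (l : Measure (Γ.K × Γ.Strategy)) (_ : IsProbabilityMeasure l) (F : Ultrafilter ℕ),
      (F : Filter ℕ) ≤ atTop ∧
      (∀ φ : Γ.K × Γ.Strategy → ℝ, Continuous φ → Tendsto (fun n : ℕ => (1 / ((n : ℝ) + 1)) *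
        ∑ m ∈ Finset.range (n + 1), Γ.EE p1 σ0 m (fun z => φ (Γ.emb σ0 z))) F (nhds (∫ x, φ x ∂l))) ∧
      (∀ φ : Γ.K × Γ.Strategy → ℝ, Continuous φ → ∫ x, Γ.PP φ x ∂l = ∫ x, φ x ∂l) ∧
      Γ.pay p1 σ0 ≤ ∫ x, Γ.g x.1 (x.2 []) ∂l := by
  let F : Ultrafilter ℕ := Ultrafilter.of atTop
  have hF : (F : Filter ℕ) ≤ atTop := Ultrafilter.of_le atTop
  let ls : ℕ → ProbabilityMeasure (Γ.K × Γ.Strategy) := fun n => ⟨Γ.cs p1 σ0 n, Γ.cs_prob p1 hp σ0 n⟩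
  have hlim : Tendsto ls F (nhds (F.map ls).lim) := Ultrafilter.le_nhds_lim (F.map ls)
  set L := (F.map ls).lim
  rw [ProbabilityMeasure.tendsto_iff_forall_integral_tendsto] at hlim
  have hT : ∀ φ : Γ.K × Γ.Strategy → ℝ, Continuous φ → Tendsto (fun n : ℕ => (1 / ((n : ℝ) + 1)) *
        ∑ m ∈ Finset.range (n + 1), Γ.EE p1 σ0 m (fun z => φ (Γ.emb σ0 z))) F
        (nhds (∫ x, φ x ∂(L : Measure (Γ.K × Γ.Strategy)))) := by
    intro φ hφ
    have := hlim (BoundedContinuousFunction.mkOfCompact ⟨φ, hφ⟩)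
    simp only [BoundedContinuousFunction.mkOfCompact_apply, ContinuousMap.coe_mk] at this
    refine this.congr fun n => ?_
    exact Γ.cs_int p1 hp σ0 n φ
  have hnat : Tendsto (fun n : ℕ => (n : ℝ) + 1) atTop atTop :=
    tendsto_atTop_add_const_right _ _ tendsto_natCast_atTop_atTop
  refine ⟨L, L.2, F, hF, hT, ?_, ?_⟩
  · intro φ hφ
    obtain ⟨C, hC⟩ := Γ.exists_bound φ hφ
    have h1 := (hT _ (Γ.continuous_PP φ hφ)).sub (hT φ hφ)
    have h2 : Tendsto (fun n : ℕ => (2 * C) / ((n : ℝ) + 1)) F (nhds 0) :=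
      (tendsto_const_nhds.div_atTop hnat).mono_left hF
    have h3 := squeeze_zero_norm (fun n : ℕ => ?_) h2 (f := fun n : ℕ => (1 / ((n : ℝ) + 1)) *
        ∑ m ∈ Finset.range (n + 1), Γ.EE p1 σ0 m (fun z => Γ.PP φ (Γ.emb σ0 z)) - (1 / ((n : ℝ) + 1)) *
        ∑ m ∈ Finset.range (n + 1), Γ.EE p1 σ0 m (fun z => φ (Γ.emb σ0 z)))
    · have := tendsto_nhds_unique h1 h3
      linarith
    · have e : ∀ m, Γ.EE p1 σ0 m (fun z => Γ.PP φ (Γ.emb σ0 z)) = Γ.EE p1 σ0 (m + 1) (fun z => φ (Γ.emb σ0 z)) := by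
        intro m
        rw [EE_step]; congr 1; funext z; rw [Pop_emb]
      simp only [e]
      rw [← mul_sub, ← Finset.sum_sub_distrib, Finset.sum_range_sub
        (fun m => Γ.EE p1 σ0 m (fun z => φ (Γ.emb σ0 z)))]
      have hb : ∀ m, |Γ.EE p1 σ0 m (fun z => φ (Γ.emb σ0 z))| ≤ C := by
        intro m
        rw [abs_le]
        constructor
        · have := Γ.EE_mono p1 hp.1 σ0 m (fun _ => -C) (fun z => φ (Γ.emb σ0 z)) fun z => (abs_le.1 (hC _)).1
          rwa [Γ.EE_const p1 hp] at this
        · have := Γ.EE_mono p1 hp.1 σ0 m (fun z => φ (Γ.emb σ0 z)) (fun _ => C) fun z => (abs_le.1 (hC _)).2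
          rwa [Γ.EE_const p1 hp] at this
      have h4 := (abs_sub _ _).trans (add_le_add (hb (n + 1)) (hb 0))
      rw [Real.norm_eq_abs, abs_mul, abs_of_nonneg (by positivity : (0 : ℝ) ≤ 1 / ((n : ℝ) + 1)),
        one_div, inv_mul_eq_div]
      gcongr
      linarith
  · obtain ⟨c, hc, hle⟩ := Γ.fatou p1 hp.1 σ0
    have h1 := hT _ (Γ.continuous_KA Γ.g)
    have h2 : Tendsto (fun n => c (n + 1)) F (nhds (Γ.pay p1 σ0)) :=
      (hc.comp (tendsto_add_atTop_nat 1)).mono_left hF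
    refine le_of_tendsto_of_tendsto' h2 h1 fun n => (hle (n + 1)).trans (le_of_eq ?_)
    rw [EE_avg]
    push_cast
    simp [emb, shift]

end POMDP


open ProbabilityTheory

lemma vecMeasure_integral {α : Type*} [Fintype α] [MeasurableSpace α] [MeasurableSingletonClass α]
    (p : α → ℝ) (hp : ∀ a, 0 ≤ p a) (f : α → ℝ) : ∫ a, f a ∂(vecMeasure p) = ∑ a, p a * f a := by
  unfold vecMeasure
  rw [integral_finsetSum_measure fun a _ =>
    (integrable_dirac (by simp)).smul_measure ENNReal.ofReal_ne_top]
  refine Finset.sum_congr rfl fun a _ => ?_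
  rw [integral_smul_measure, integral_dirac, ENNReal.toReal_ofReal (hp a), smul_eq_mul]

lemma vecMeasure_prob {α : Type*} [Fintype α] [MeasurableSpace α] 
    (p : α → ℝ) (hp : ∀ a, 0 ≤ p a) (hs : ∑ a, p a = 1) : IsProbabilityMeasure (vecMeasure p) := by
  constructor
  unfold vecMeasure
  simp only [Measure.finsetSum_apply, Measure.smul_apply, measure_univ, smul_eq_mul, mul_one]
  rw [← ENNReal.ofReal_sum_of_nonneg fun a _ => hp a, hs, ENNReal.ofReal_one]

lemma vecMeasure_ae {α : Type*} [Fintype α] [MeasurableSpace α] [MeasurableSingletonClass α]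
    (p : α → ℝ) (E : α → Prop) (h : ∀ᵐ a ∂(vecMeasure p), E a) (a : α) (ha : 0 < p a) : E a := by
  by_contra hc
  rw [ae_iff] at h
  unfold vecMeasure at h
  rw [Measure.finsetSum_apply, Finset.sum_eq_zero_iff] at h
  have := h a (Finset.mem_univ a)
  rw [Measure.smul_apply, smul_eq_mul, mul_eq_zero] at this
  rcases this with h1 | h1
  · rw [ENNReal.ofReal_eq_zero] at h1; linarith
  · rw [Measure.dirac_apply, Set.indicator_of_mem (by exact hc)] at h1
    simp at h1

namespace POMDP
variable (Γ : POMDP)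

/-- transition kernel -/
noncomputable def kap : Kernel (Γ.K × Γ.Strategy) (Γ.K × Γ.S) :=
  (Kernel.ofFunOfCountable (fun p : Γ.K × Γ.A => vecMeasure (Γ.q p.1 p.2))).comap
    (fun x => (x.1, x.2 [])) (Γ.continuous_KA (fun k a => (k, a))).measurable

lemma kap_apply (x) : Γ.kap x = vecMeasure (Γ.q x.1 (x.2 [])) := rfl

instance : IsMarkovKernel Γ.kap :=
  ⟨fun _ => vecMeasure_prob _ (Γ.q_nonneg _ _) (Γ.q_sum _ _)⟩

/-- one step -/
def stp (w : (Γ.K × Γ.Strategy) × (Γ.K × Γ.S)) : Γ.K × Γ.Strategy := (w.2.1, Γ.nextS w.1.2 w.2.2)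

lemma measurable_stp : Measurable Γ.stp := by
  have : Continuous Γ.stp := by
    have h : Continuous (fun p : (Γ.K × Γ.S) × (Γ.K × Γ.Strategy) => Γ.stp (p.2, p.1)) :=
      continuous_prod_of_discrete_left.2 fun y => Γ.continuous_stepX y
    exact h.comp continuous_swap
  exact this.measurable

section
variable (l : Measure (Γ.K × Γ.Strategy)) [IsProbabilityMeasure l]

lemma mp_fst : MeasurePreserving (Prod.fst : (Γ.K × Γ.Strategy) × (Γ.K × Γ.S) → _) (l ⊗ₘ Γ.kap) l :=
  ⟨measurable_fst, by
    have := Measure.fst_compProd l Γ.kap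
    exact this⟩

lemma int_kap (f : (Γ.K × Γ.Strategy) × (Γ.K × Γ.S) → ℝ) (hf : Integrable f (l ⊗ₘ Γ.kap)) :
    ∫ w, f w ∂(l ⊗ₘ Γ.kap) = ∫ x, ∑ y, Γ.q x.1 (x.2 []) y * f (x, y) ∂l := by
  rw [Measure.integral_compProd hf]
  congr 1; funext x
  rw [kap_apply, vecMeasure_integral _ (Γ.q_nonneg _ _)]

lemma mp_stp
    (hinv : ∀ φ : Γ.K × Γ.Strategy → ℝ, Continuous φ → ∫ x, Γ.PP φ x ∂l = ∫ x, φ x ∂l) : MeasurePreserving Γ.stp (l ⊗ₘ Γ.kap) l := by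
  refine ⟨Γ.measurable_stp, ?_⟩
  have : IsProbabilityMeasure (Measure.map Γ.stp (l ⊗ₘ Γ.kap)) :=
    Measure.isProbabilityMeasure_map Γ.measurable_stp.aemeasurable
  refine ext_of_forall_integral_eq_of_IsFiniteMeasure fun φ => ?_
  rw [integral_map Γ.measurable_stp.aemeasurable φ.continuous.measurable.aestronglyMeasurable,
    Γ.int_kap l, ← hinv φ φ.continuous]
  · rfl
  · refine Integrable.of_bound (φ.continuous.measurable.comp Γ.measurable_stp).aestronglyMeasurable ‖φ‖
      (ae_of_all _ fun w => φ.norm_coe_le_norm _)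

lemma ae_next
    (hinv : ∀ φ : Γ.K × Γ.Strategy → ℝ, Continuous φ → ∫ x, Γ.PP φ x ∂l = ∫ x, φ x ∂l) (E : Γ.K × Γ.Strategy → Prop) (hE : ∀ᵐ x ∂l, E x) :
    ∀ᵐ x ∂l, ∀ y, 0 < Γ.q x.1 (x.2 []) y → E (y.1, Γ.nextS x.2 y.2) := by
  have h1 := (Γ.mp_stp l hinv).quasiMeasurePreserving.ae hE
  filter_upwards [Measure.ae_ae_of_ae_compProd h1] with x hx y hy
  rw [kap_apply] at hx
  exact vecMeasure_ae _ _ hx y hy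

end
end POMDP


open ProbabilityTheory

namespace POMDP
variable (Γ : POMDP)

section
variable (l : Measure (Γ.K × Γ.Strategy)) [IsProbabilityMeasure l]

lemma memLp_cont (φ : Γ.K × Γ.Strategy → ℝ) (hφ : Continuous φ) : MemLp φ 2 l := by
  obtain ⟨C, hC⟩ := Γ.exists_bound φ hφ
  exact MemLp.of_bound hφ.measurable.aestronglyMeasurable C (ae_of_all _ hC)

/-- class of a continuous function -/
noncomputable def cl (φ : Γ.K × Γ.Strategy → ℝ) (hφ : Continuous φ) : Lp ℝ 2 l :=
  (Γ.memLp_cont l φ hφ).toLp φ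

/-- pull-back along projection -/
noncomputable def U0 : Lp ℝ 2 l →L[ℝ] Lp ℝ 2 (l ⊗ₘ Γ.kap) :=
  (Lp.compMeasurePreservingₗᵢ ℝ Prod.fst (Γ.mp_fst l)).toContinuousLinearMap

lemma U0_norm (f : Lp ℝ 2 l) : ‖Γ.U0 l f‖ = ‖f‖ := LinearIsometry.norm_map _ f

lemma U0_ae (f : Lp ℝ 2 l) : (Γ.U0 l f : _ → ℝ) =ᵐ[l ⊗ₘ Γ.kap] fun w => f w.1 :=
  Lp.coeFn_compMeasurePreserving f (Γ.mp_fst l)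

variable (hinv : ∀ φ : Γ.K × Γ.Strategy → ℝ, Continuous φ → ∫ x, Γ.PP φ x ∂l = ∫ x, φ x ∂l)

/-- pull-back along the step map -/
noncomputable def U1 : Lp ℝ 2 l →L[ℝ] Lp ℝ 2 (l ⊗ₘ Γ.kap) :=
  (Lp.compMeasurePreservingₗᵢ ℝ Γ.stp (Γ.mp_stp l hinv)).toContinuousLinearMap

lemma U1_norm (f : Lp ℝ 2 l) : ‖Γ.U1 l hinv f‖ = ‖f‖ := LinearIsometry.norm_map _ f

lemma U1_ae (f : Lp ℝ 2 l) : (Γ.U1 l hinv f : _ → ℝ) =ᵐ[l ⊗ₘ Γ.kap] fun w => f (Γ.stp w) :=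
  Lp.coeFn_compMeasurePreserving f (Γ.mp_stp l hinv)

/-- Markov operator on `L²` -/
noncomputable def TT : Lp ℝ 2 l →L[ℝ] Lp ℝ 2 l :=
  (ContinuousLinearMap.adjoint (Γ.U0 l)).comp (Γ.U1 l hinv)

lemma TT_inner (v f : Lp ℝ 2 l) : inner ℝ v (Γ.TT l hinv f) = inner ℝ (Γ.U0 l v) (Γ.U1 l hinv f) := by
  unfold TT
  rw [ContinuousLinearMap.comp_apply, ContinuousLinearMap.adjoint_inner_right]

lemma TT_norm : ‖Γ.TT l hinv‖ ≤ 1 := by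
  refine ContinuousLinearMap.opNorm_le_bound _ zero_le_one fun f => ?_
  rw [one_mul]
  have h := real_inner_self_eq_norm_sq (Γ.TT l hinv f)
  rw [TT_inner] at h
  have h2 := real_inner_le_norm (Γ.U0 l (Γ.TT l hinv f)) (Γ.U1 l hinv f)
  rw [U0_norm, U1_norm, h] at h2
  nlinarith [norm_nonneg (Γ.TT l hinv f), norm_nonneg f]

lemma TT_cl (φ : Γ.K × Γ.Strategy → ℝ) (hφ : Continuous φ) :
    Γ.TT l hinv (Γ.cl l φ hφ) = Γ.cl l (Γ.PP φ) (Γ.continuous_PP φ hφ) := by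
  refine ext_inner_left ℝ fun v => ?_
  rw [TT_inner, L2.inner_def, L2.inner_def]
  have e1 : (fun w => inner ℝ (Γ.U0 l v w) (Γ.U1 l hinv (Γ.cl l φ hφ) w)) =ᵐ[l ⊗ₘ Γ.kap]
      fun w => v w.1 * φ (Γ.stp w) := by
    have h3 : (Γ.cl l φ hφ : _ → ℝ) =ᵐ[l] φ := MemLp.coeFn_toLp _
    have h4 := (Γ.mp_stp l hinv).quasiMeasurePreserving.ae h3
    filter_upwards [Γ.U0_ae l v, Γ.U1_ae l hinv (Γ.cl l φ hφ), h4] with w h1 h2 h5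
    rw [h1, h2, h5]
    simp [mul_comm]
  have hi := (L2.integrable_inner (𝕜 := ℝ) (Γ.U0 l v) (Γ.U1 l hinv (Γ.cl l φ hφ))).congr e1
  rw [integral_congr_ae e1, Γ.int_kap l _ hi]
  refine integral_congr_ae ?_
  have h3 : (Γ.cl l (Γ.PP φ) (Γ.continuous_PP φ hφ) : _ → ℝ) =ᵐ[l] Γ.PP φ := MemLp.coeFn_toLp _
  filter_upwards [h3] with x hx
  rw [hx]
  simp only [PP, stp, RCLike.inner_apply, conj_trivial, Finset.sum_mul]
  refine Finset.sum_congr rfl fun y _ => by ring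

lemma birk (n : ℕ) : birkhoffSum (Γ.TT l hinv) id n (Γ.cl l (fun x => Γ.g x.1 (x.2 [])) (Γ.continuous_KA Γ.g))
    = Γ.cl l (fun x => Γ.UU n x.1 x.2) (Γ.continuous_UU n) := by
  induction n with
  | zero =>
    rw [birkhoffSum_zero]
    exact (MemLp.toLp_zero _).symm
  | succ n ih =>
    have e : birkhoffSum (Γ.TT l hinv) id (n + 1) (Γ.cl l (fun x => Γ.g x.1 (x.2 [])) (Γ.continuous_KA Γ.g))
      = Γ.cl l (fun x => Γ.g x.1 (x.2 [])) (Γ.continuous_KA Γ.g) + Γ.TT l hinv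
        (birkhoffSum (Γ.TT l hinv) id n (Γ.cl l (fun x => Γ.g x.1 (x.2 [])) (Γ.continuous_KA Γ.g))) := by
      simp only [birkhoffSum, id]
      rw [Finset.sum_range_succ', map_sum, add_comm]
      congr 1
      refine Finset.sum_congr rfl fun i _ => ?_
      rw [Function.iterate_succ_apply']
    rw [e, ih, TT_cl]
    exact (MemLp.toLp_add _ _).symm

lemma fix_eq (f : Lp ℝ 2 l) (hf : Γ.TT l hinv f = f) :
    ∀ᵐ x ∂l, ∀ y, 0 < Γ.q x.1 (x.2 []) y → f (y.1, Γ.nextS x.2 y.2) = f x := by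
  have h1 : Γ.U1 l hinv f = Γ.U0 l f := by
    rw [← sub_eq_zero, ← norm_eq_zero, ← sq_eq_zero_iff, norm_sub_sq_real, real_inner_comm, ← TT_inner, hf,
      U0_norm, U1_norm, real_inner_self_eq_norm_sq]
    ring
  have h2 : ∀ᵐ w ∂(l ⊗ₘ Γ.kap), f (Γ.stp w) = f w.1 := by
    have h3 := Γ.U1_ae l hinv f
    rw [h1] at h3
    filter_upwards [h3, Γ.U0_ae l f] with w a b
    rw [← a, ← b]
  filter_upwards [Measure.ae_ae_of_ae_compProd h2] with x hx y hy
  rw [kap_apply] at hx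
  exact vecMeasure_ae _ _ hx y hy

lemma int_UU (hinv : ∀ φ : Γ.K × Γ.Strategy → ℝ, Continuous φ → ∫ x, Γ.PP φ x ∂l = ∫ x, φ x ∂l) (n : ℕ) :
    ∫ x, Γ.UU n x.1 x.2 ∂l = n * ∫ x, Γ.g x.1 (x.2 []) ∂l := by
  have hi : ∀ φ : Γ.K × Γ.Strategy → ℝ, Continuous φ → Integrable φ l := fun φ hφ =>
    (Γ.memLp_cont l φ hφ).integrable (by norm_num)
  induction n with
  | zero => simp [UU]
  | succ n ih =>
    have : ∫ x, Γ.UU (n + 1) x.1 x.2 ∂l = ∫ x, (Γ.g x.1 (x.2 []) + Γ.PP (fun x => Γ.UU n x.1 x.2) x) ∂l := rfl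
    rw [this, integral_add (hi _ (Γ.continuous_KA Γ.g)) (hi _ (Γ.continuous_PP _ (Γ.continuous_UU n))),
      hinv _ (Γ.continuous_UU n), ih]
    push_cast; ring

/-- iterated good sets -/
def GG (E0 : Set (Γ.K × Γ.Strategy)) : ℕ → Set (Γ.K × Γ.Strategy)
  | 0 => E0
  | n + 1 => {x | x ∈ E0 ∧ ∀ y, 0 < Γ.q x.1 (x.2 []) y → (y.1, Γ.nextS x.2 y.2) ∈ GG E0 n}

lemma meas_next (E : Set (Γ.K × Γ.Strategy)) (hE : MeasurableSet E) :
    MeasurableSet {x : Γ.K × Γ.Strategy | ∀ y, 0 < Γ.q x.1 (x.2 []) y → (y.1, Γ.nextS x.2 y.2) ∈ E} := by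
  rw [show {x : Γ.K × Γ.Strategy | ∀ y, 0 < Γ.q x.1 (x.2 []) y → (y.1, Γ.nextS x.2 y.2) ∈ E} =
    ⋂ y, ({x | 0 < Γ.q x.1 (x.2 []) y}ᶜ ∪ {x | (y.1, Γ.nextS x.2 y.2) ∈ E}) by
      ext x; simp [or_iff_not_imp_left]]
  refine MeasurableSet.iInter fun y => MeasurableSet.union (MeasurableSet.compl ?_) ?_
  · exact measurableSet_lt measurable_const (Γ.continuous_KA (fun k a => Γ.q k a y)).measurable
  · exact (Γ.continuous_stepX y).measurable hE

lemma meas_GG (E0 : Set (Γ.K × Γ.Strategy)) (hE : MeasurableSet E0) (n) : MeasurableSet (Γ.GG E0 n) := by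
  induction n with
  | zero => exact hE
  | succ n ih => exact hE.inter (Γ.meas_next _ ih)

theorem partE2 (hinv : ∀ φ : Γ.K × Γ.Strategy → ℝ, Continuous φ → ∫ x, Γ.PP φ x ∂l = ∫ x, φ x ∂l) :
    ∃ (G : Set (Γ.K × Γ.Strategy)) (gb : Γ.K × Γ.Strategy → ℝ) (N : ℕ → ℕ),
    MeasurableSet G ∧ Measurable gb ∧ Tendsto N atTop atTop ∧
    (∀ x ∈ G, Tendsto (fun j => Γ.UU (N j) x.1 x.2 / N j) atTop (nhds (gb x))) ∧
    (∀ k σ, (k, σ) ∈ G → ∀ y, 0 < Γ.q k (σ []) y →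
      (y.1, Γ.nextS σ y.2) ∈ G ∧ gb (y.1, Γ.nextS σ y.2) = gb (k, σ)) ∧
    (∀ᵐ x ∂l, x ∈ G) ∧ ∫ x, gb x ∂l = ∫ x, Γ.g x.1 (x.2 []) ∂l := by
  have hme := ContinuousLinearMap.tendsto_birkhoffAverage_orthogonalProjection (Γ.TT l hinv) (Γ.TT_norm l hinv)
    (Γ.cl l (fun x => Γ.g x.1 (x.2 [])) (Γ.continuous_KA Γ.g))
  set pf := (((Γ.TT l hinv : Lp ℝ 2 l →ₗ[ℝ] Lp ℝ 2 l)).eqLocus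
    ((1 : Lp ℝ 2 l →L[ℝ] Lp ℝ 2 l) : Lp ℝ 2 l →ₗ[ℝ] Lp ℝ 2 l)).orthogonalProjectionOnto
      (Γ.cl l (fun x => Γ.g x.1 (x.2 [])) (Γ.continuous_KA Γ.g)) with hpf
  set f : Lp ℝ 2 l := pf.1 with hf
  have hfix : Γ.TT l hinv f = f := pf.2
  obtain ⟨N, hN, hae⟩ := (tendstoInMeasure_of_tendsto_Lp hme).exists_seq_tendsto_ae
  have hav : ∀ n, ((birkhoffAverage ℝ (Γ.TT l hinv) id n (Γ.cl l (fun x => Γ.g x.1 (x.2 []))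
      (Γ.continuous_KA Γ.g)) : Lp ℝ 2 l) : _ → ℝ) =ᵐ[l] fun x => Γ.UU n x.1 x.2 / n := by
    intro n
    rw [birkhoffAverage, birk]
    have h3 : (Γ.cl l (fun x => Γ.UU n x.1 x.2) (Γ.continuous_UU n) : _ → ℝ) =ᵐ[l] _ := MemLp.coeFn_toLp _
    filter_upwards [Lp.coeFn_smul ((n : ℝ)⁻¹) (Γ.cl l (fun x => Γ.UU n x.1 x.2) (Γ.continuous_UU n)), h3]
      with x h1 h2
    rw [h1, Pi.smul_apply, h2, smul_eq_mul, inv_mul_eq_div]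
  have hconv : ∀ᵐ x ∂l, Tendsto (fun j => Γ.UU (N j) x.1 x.2 / N j) atTop (nhds (f x)) := by
    filter_upwards [hae, ae_all_iff.2 hav] with x h1 h2
    refine h1.congr fun j => ?_
    exact h2 _
  have hmf : Measurable (f : _ → ℝ) := (Lp.stronglyMeasurable f).measurable
  have hmU : ∀ j, Measurable (fun x : Γ.K × Γ.Strategy => Γ.UU (N j) x.1 x.2 / N j) := fun j =>
    (Γ.continuous_UU _).measurable.div_const _
  let E0 : Set (Γ.K × Γ.Strategy) := {x | Tendsto (fun j => Γ.UU (N j) x.1 x.2 / N j) atTop (nhds (f x))} ∩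
    {x | ∀ y, 0 < Γ.q x.1 (x.2 []) y → f (y.1, Γ.nextS x.2 y.2) = f x}
  have hE0m : MeasurableSet E0 := by
    refine MeasurableSet.inter (measurableSet_tendsto_fun hmU hmf) ?_
    rw [show {x : Γ.K × Γ.Strategy | ∀ y, 0 < Γ.q x.1 (x.2 []) y → f (y.1, Γ.nextS x.2 y.2) = f x} =
      ⋂ y, ({x | 0 < Γ.q x.1 (x.2 []) y}ᶜ ∪ {x | f (y.1, Γ.nextS x.2 y.2) = f x}) by
        ext x; simp [or_iff_not_imp_left]]
    refine MeasurableSet.iInter fun y => MeasurableSet.union (MeasurableSet.compl ?_) ?_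
    · exact measurableSet_lt measurable_const (Γ.continuous_KA (fun k a => Γ.q k a y)).measurable
    · exact measurableSet_eq_fun (hmf.comp (Γ.continuous_stepX y).measurable) hmf
  have hE0 : ∀ᵐ x ∂l, x ∈ E0 := by
    filter_upwards [hconv, Γ.fix_eq l hinv f hfix] with x h1 h2 using ⟨h1, h2⟩
  have hGn : ∀ n, ∀ᵐ x ∂l, x ∈ Γ.GG E0 n := by
    intro n
    induction n with
    | zero => exact hE0
    | succ n ih =>
      filter_upwards [hE0, Γ.ae_next l hinv _ ih] with x h1 h2 using ⟨h1, h2⟩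
  refine ⟨⋂ n, Γ.GG E0 n, f, N, MeasurableSet.iInter (Γ.meas_GG E0 hE0m), hmf, hN.tendsto_atTop, ?_, ?_, ?_, ?_⟩
  · intro x hx
    exact (Set.mem_iInter.1 hx 0).1
  · intro k σ hx y hy
    rw [Set.mem_iInter] at hx
    refine ⟨Set.mem_iInter.2 fun n => (hx (n + 1)).2 y hy, (hx 0).2 y hy⟩
  · filter_upwards [ae_all_iff.2 hGn] with x hx using Set.mem_iInter.2 hx
  · have h1 : Tendsto (fun j => ∫ x, Γ.UU (N j) x.1 x.2 / N j ∂l) atTop (nhds (∫ x, f x ∂l)) := by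
      refine tendsto_integral_of_dominated_convergence (fun _ => 1)
        (fun j => (hmU j).aestronglyMeasurable) (integrable_const _) (fun j => ae_of_all _ fun x => ?_) hconv
      have := Γ.UU_bound (N j) x.1 x.2
      rw [Real.norm_eq_abs, abs_of_nonneg (div_nonneg this.1 (Nat.cast_nonneg _))]
      exact div_le_one_of_le₀ this.2 (Nat.cast_nonneg _)
    refine tendsto_nhds_unique h1 (tendsto_const_nhds.congr' ?_)
    filter_upwards [hN.tendsto_atTop.eventually (eventually_gt_atTop 0)] with j hj
    rw [integral_div, Γ.int_UU l hinv]
    have : (N j : ℝ) ≠ 0 := by positivity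
    field_simp

end
end POMDP


open ProbabilityTheory

/-- clamp to the unit interval -/
noncomputable def clamp (t : ℝ) : ℝ := min 1 (max 0 t)

lemma clamp_mono {s t : ℝ} (h : s ≤ t) : clamp s ≤ clamp t :=
  min_le_min le_rfl (max_le_max le_rfl h)

lemma clamp_nonneg (t : ℝ) : 0 ≤ clamp t := le_min zero_le_one (le_max_left _ _)
lemma clamp_le_one (t : ℝ) : clamp t ≤ 1 := min_le_left _ _
lemma clamp_of_nonpos {t : ℝ} (h : t ≤ 0) : clamp t = 0 := by simp [clamp, h]
lemma clamp_of_one_le {t : ℝ} (h : 1 ≤ t) : clamp t = 1 := by simp [clamp, h]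

lemma clamp_lip (s t : ℝ) : |clamp s - clamp t| ≤ |s - t| := by
  unfold clamp
  refine (abs_min_sub_min_le_max _ _ _ _).trans ?_
  rw [sub_self, abs_zero]
  refine max_le (abs_nonneg _) ((abs_max_sub_max_le_max _ _ _ _).trans ?_)
  simp

lemma continuous_clamp : Continuous clamp := by
  unfold clamp; fun_prop

/-- partition weights -/
noncomputable def pw (i : ℕ) (t : ℝ) : ℝ := clamp (t - i + 1) - clamp (t - i)

lemma pw_nonneg (i t) : 0 ≤ pw i t := sub_nonneg.2 (clamp_mono (by linarith))

lemma pw_sum (r : ℕ) (t : ℝ) : ∑ i ∈ Finset.range (r + 1), pw i t ≤ 1 := by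
  have h := Finset.sum_range_sub' (fun i : ℕ => clamp (t - i + 1)) (r + 1)
  have : ∑ i ∈ Finset.range (r + 1), pw i t = clamp (t - (0 : ℕ) + 1) - clamp (t - (r + 1 : ℕ) + 1) := by
    rw [← h]
    refine Finset.sum_congr rfl fun i _ => ?_
    unfold pw
    congr 2
    push_cast; ring
  rw [this]
  have := clamp_le_one (t - (0 : ℕ) + 1)
  have := clamp_nonneg (t - (r + 1 : ℕ) + 1)
  linarith

lemma pw_nat (i n : ℕ) : pw i n = if i = n then 1 else 0 := by
  unfold pw
  split_ifs with h
  · subst h; simp [clamp]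
  · rcases lt_or_gt_of_ne h with h | h
    · have : (i : ℝ) + 1 ≤ n := by exact_mod_cast h
      rw [clamp_of_one_le (by linarith), clamp_of_one_le (by linarith)]; simp
    · have : (n : ℝ) + 1 ≤ i := by exact_mod_cast h
      rw [clamp_of_nonpos (by linarith), clamp_of_nonpos (by linarith)]; simp

lemma pw_lip (i : ℕ) (s t : ℝ) : |pw i s - pw i t| ≤ 2 * |s - t| := by
  unfold pw
  have h1 := clamp_lip (s - i + 1) (t - i + 1)
  have h2 := clamp_lip (s - i) (t - i)
  rw [show s - i + 1 - (t - i + 1) = s - t by ring] at h1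
  rw [show s - i - (t - i) = s - t by ring] at h2
  rw [abs_le] at *
  constructor <;> linarith [h1.1, h1.2, h2.1, h2.2]

lemma continuous_pw (i : ℕ) : Continuous (pw i) := by
  unfold pw
  exact (continuous_clamp.comp (by fun_prop)).sub (continuous_clamp.comp (by fun_prop))

namespace POMDP
variable (Γ : POMDP)

/-- interpolation of rewards -/
noncomputable def itp (R : ℕ → Γ.K → ℝ) (r : ℕ) (k : Γ.K) (t : ℝ) : ℝ :=
  ∑ i ∈ Finset.range (r + 1), pw i t * R i k

lemma itp_nat (R : ℕ → Γ.K → ℝ) (r : ℕ) (k : Γ.K) (n : ℕ) (hn : n ≤ r) : Γ.itp R r k n = R n k := by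
  unfold itp
  rw [Finset.sum_eq_single n]
  · simp [pw_nat]
  · intro i _ hi; simp [pw_nat, hi]
  · intro h; exact absurd (Finset.mem_range.2 (by omega)) h

lemma itp_lip (R : ℕ → Γ.K → ℝ) (hR : ∀ i k, 0 ≤ R i k ∧ R i k ≤ 1) (r : ℕ) (k : Γ.K) (s t : ℝ) :
    |Γ.itp R r k s - Γ.itp R r k t| ≤ 2 * (r + 1) * |s - t| := by
  unfold itp
  rw [← Finset.sum_sub_distrib]
  refine (Finset.abs_sum_le_sum_abs _ _).trans ?_
  have : ∀ i ∈ Finset.range (r + 1), |pw i s * R i k - pw i t * R i k| ≤ 2 * |s - t| := by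
    intro i _
    rw [← sub_mul, abs_mul, abs_of_nonneg (hR i k).1]
    exact (mul_le_of_le_one_right (abs_nonneg _) (hR i k).2).trans (pw_lip i s t)
  refine (Finset.sum_le_sum this).trans ?_
  simp
  linarith

lemma continuous_itp (R : ℕ → Γ.K → ℝ) (r : ℕ) (θ : Γ.Strategy → ℝ) (hθ : Continuous θ) :
    Continuous (fun x : Γ.K × Γ.Strategy => Γ.itp R r x.1 (θ x.2)) := by
  unfold itp
  refine continuous_finsetSum _ fun i _ => ?_
  exact ((continuous_pw i).comp (hθ.comp continuous_snd)).mul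
    ((continuous_of_discreteTopology (f := R i)).comp continuous_fst)

/-- choose, for each history, the best index -/
lemma select (p1 : Γ.K → ℝ) (hp : IsBelief p1) (σ0 : Γ.Strategy) (m : ℕ) (R : ℕ → Γ.K → ℝ)
    (hR : ∀ i k, 0 ≤ R i k ∧ R i k ≤ 1) (r : ℕ) (θ : Γ.Strategy → ℝ) :
    ∃ s : Γ.Hist → ℕ, Γ.EE p1 σ0 m (fun z => Γ.itp R r (Γ.emb σ0 z).1 (θ (Γ.emb σ0 z).2)) ≤
      Γ.EE p1 σ0 m (fun z => R (s z.2) z.1) := by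
  have hex : ∀ h : Γ.Hist, ∃ i ∈ Finset.range (r + 1), ∀ j ∈ Finset.range (r + 1),
      ∑ k, Γ.ww p1 σ0 m (k, h) * R j k ≤ ∑ k, Γ.ww p1 σ0 m (k, h) * R i k := fun h =>
    Finset.exists_max_image _ (fun j => ∑ k, Γ.ww p1 σ0 m (k, h) * R j k) ⟨0, by simp⟩
  choose s hs1 hs using hex
  refine ⟨s, ?_⟩
  rw [EE_eq, EE_eq, VV, Finset.sum_product_right, Finset.sum_product_right]
  refine Finset.sum_le_sum fun h _ => ?_
  simp only [emb, itp]
  simp only [Finset.mul_sum]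
  rw [Finset.sum_comm]
  have h0 : 0 ≤ ∑ k, Γ.ww p1 σ0 m (k, h) * R (s h) k :=
    Finset.sum_nonneg fun k _ => mul_nonneg (Γ.ww_nonneg p1 hp.1 σ0 m _) (hR _ _).1
  calc _ = ∑ i ∈ Finset.range (r + 1), pw i (θ (Γ.shift σ0 h)) * ∑ k, Γ.ww p1 σ0 m (k, h) * R i k := by
        refine Finset.sum_congr rfl fun i _ => ?_
        rw [Finset.mul_sum]
        refine Finset.sum_congr rfl fun k _ => ?_
        ring
    _ ≤ ∑ i ∈ Finset.range (r + 1), pw i (θ (Γ.shift σ0 h)) * ∑ k, Γ.ww p1 σ0 m (k, h) * R (s h) k :=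
        Finset.sum_le_sum fun i hi => mul_le_mul_of_nonneg_left (hs h i hi) (pw_nonneg _ _)
    _ ≤ _ := by
        rw [← Finset.sum_mul]
        exact mul_le_of_le_one_left h0 (pw_sum _ _)

lemma rew_exists (τ : ℕ → Γ.Strategy) (ε : ℝ) (hε : 0 < ε) :
    ∃ R : ℕ → Γ.K → ℝ, (∀ i k, 0 ≤ R i k ∧ R i k ≤ 1) ∧ (∀ i k, Γ.Guar (τ i) k (R i k)) ∧
      ∀ i k γ, γ ≤ 1 → Γ.Guar (τ i) k γ → γ - ε ≤ R i k := by
  let S : ℕ → Γ.K → Set ℝ := fun i k => {γ | γ ≤ 1 ∧ Γ.Guar (τ i) k γ}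
  have hS0 : ∀ i k, (0 : ℝ) ∈ S i k := fun i k => ⟨zero_le_one, Guar.zero Γ _ _⟩
  have hb : ∀ i k, BddAbove (S i k) := fun i k => ⟨1, fun γ h => h.1⟩
  refine ⟨fun i k => max 0 (sSup (S i k) - ε), fun i k => ⟨le_max_left _ _, max_le zero_le_one ?_⟩,
    fun i k => ?_, fun i k γ h1 h2 => ?_⟩
  · have : sSup (S i k) ≤ 1 := csSup_le ⟨0, hS0 i k⟩ fun γ h => h.1
    linarith
  · obtain ⟨γ, hγ, hlt⟩ := exists_lt_of_lt_csSup ⟨0, hS0 i k⟩ (sub_lt_self (sSup (S i k)) hε)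
    rcases le_total 0 (sSup (S i k) - ε) with h | h
    · simp only [max_eq_right h]; exact Guar.mono Γ hγ.2 hlt.le
    · simp only [max_eq_left h]; exact Guar.zero Γ _ _
  · refine le_trans ?_ (le_max_right _ _)
    exact sub_le_sub_right (le_csSup (hb i k) ⟨h1, h2⟩) _

theorem approx (p1 : Γ.K → ℝ) (hp : IsBelief p1) (σ0 : Γ.Strategy) (ε : ℝ) (hε : 0 < ε) :
    ∃ τ, Γ.FiniteMemory τ ∧ Γ.pay p1 σ0 - 6 * ε ≤ Γ.pay p1 τ := by
  classical
  obtain ⟨l, hl, F, hF, hlim, hinv, hpay⟩ := Γ.partE1 p1 hp σ0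
  obtain ⟨G, gb, N, hGm, hgm, hN, hU, hG, hGae, hint⟩ := Γ.partE2 l hinv
  have hg01 : ∀ x ∈ G, 0 ≤ gb x ∧ gb x ≤ 1 := fun x hx =>
    ⟨ge_of_tendsto' (hU x hx) fun j => div_nonneg (Γ.UU_bound (N j) x.1 x.2).1 (Nat.cast_nonneg _),
      le_of_tendsto' (hU x hx) fun j => div_le_one_of_le₀ (Γ.UU_bound (N j) x.1 x.2).2 (Nat.cast_nonneg _)⟩
  obtain ⟨τ, hτ⟩ := Γ.fm_countable.exists_eq_range ⟨_, Γ.fm_const (σ0 [])⟩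
  have hfm : ∀ i, Γ.FiniteMemory (τ i) := fun i => by
    have : τ i ∈ {τ | Γ.FiniteMemory τ} := by rw [hτ]; exact ⟨i, rfl⟩
    exact this
  obtain ⟨R, hR, hRG, hRs⟩ := Γ.rew_exists τ ε hε
  have hcov : ∀ σ : Γ.Strategy, ∃ i, ∀ k, (k, σ) ∈ G → gb (k, σ) - 2 * ε ≤ R i k := by
    intro σ
    obtain ⟨t, ht, hgt⟩ := Γ.partD G gb N hN hU hG σ ε hε
    have : t ∈ Set.range τ := by rw [← hτ]; exact ht
    obtain ⟨i, rfl⟩ := this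
    refine ⟨i, fun k hk => ?_⟩
    have := hRs i k _ (by linarith [(hg01 _ hk).2]) (hgt k hk)
    linarith
  let T : Γ.Strategy → ℕ := fun σ => Nat.find (hcov σ)
  have hTs : ∀ σ k, (k, σ) ∈ G → gb (k, σ) - 2 * ε ≤ R (T σ) k := fun σ => Nat.find_spec (hcov σ)
  have hTm : Measurable T := by
    refine measurable_find hcov fun i => ?_
    have : {σ : Γ.Strategy | ∀ k, (k, σ) ∈ G → gb (k, σ) - 2 * ε ≤ R i k} =
      ⋂ k, ((fun σ => ((k, σ) : Γ.K × Γ.Strategy)) ⁻¹' (Gᶜ ∪ {x | gb x - 2 * ε ≤ R i x.1})) := by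
      ext σ; simp [or_iff_not_imp_left]
    rw [this]
    refine MeasurableSet.iInter fun k => measurable_prodMk_left (hGm.compl.union ?_)
    exact measurableSet_le (hgm.sub_const _) ((measurable_of_countable (R i)).comp measurable_fst)
  have hRm : ∀ T' : Γ.Strategy → ℕ, Measurable T' →
      Measurable (fun x : Γ.K × Γ.Strategy => R (T' x.2) x.1) := fun T' h =>
    (measurable_of_countable (fun p : ℕ × Γ.K => R p.1 p.2)).comp
      ((h.comp measurable_snd).prodMk measurable_fst)
  have hRi : ∀ T' : Γ.Strategy → ℕ, Measurable T' →
      Integrable (fun x : Γ.K × Γ.Strategy => R (T' x.2) x.1) l := fun T' h =>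
    Integrable.of_bound (hRm T' h).aestronglyMeasurable 1 (ae_of_all _ fun x => by
      rw [Real.norm_eq_abs, abs_of_nonneg (hR _ _).1]; exact (hR _ _).2)
  have hgi : Integrable gb l := Integrable.of_bound hgm.aestronglyMeasurable 1 (by
    filter_upwards [hGae] with x hx
    rw [Real.norm_eq_abs, abs_of_nonneg (hg01 x hx).1]; exact (hg01 x hx).2)
  have s1 : ∫ x, gb x ∂l - 2 * ε ≤ ∫ x, R (T x.2) x.1 ∂l := by
    have : ∫ x, (gb x - 2 * ε) ∂l ≤ ∫ x, R (T x.2) x.1 ∂l := by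
      refine integral_mono_ae (hgi.sub (integrable_const _)) (hRi T hTm) ?_
      filter_upwards [hGae] with x hx using hTs x.2 x.1 hx
    rw [integral_sub hgi (integrable_const _)] at this
    simpa using this
  have hTrm : ∀ r : ℕ, Measurable (fun σ => min (T σ) r) := fun r => hTm.min measurable_const
  have s2 : Tendsto (fun r : ℕ => ∫ x, R (min (T x.2) r) x.1 ∂l) atTop (nhds (∫ x, R (T x.2) x.1 ∂l)) := by
    refine tendsto_integral_of_dominated_convergence (fun _ => 1)
      (fun r => (hRm _ (hTrm r)).aestronglyMeasurable) (integrable_const _) (fun r => ae_of_all _ fun x => ?_)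
      (ae_of_all _ fun x => ?_)
    · rw [Real.norm_eq_abs, abs_of_nonneg (hR _ _).1]; exact (hR _ _).2
    · refine tendsto_const_nhds.congr' ?_
      filter_upwards [eventually_ge_atTop (T x.2)] with r hr
      rw [min_eq_left hr]
  obtain ⟨r, hr⟩ := (s2.eventually (lt_mem_nhds (sub_lt_self _ hε))).exists
  -- continuous approximation of the index
  let ν : Measure Γ.Strategy := l.map Prod.snd
  have hν : IsProbabilityMeasure ν := Measure.isProbabilityMeasure_map measurable_snd.aemeasurable
  have hTi : Integrable (fun σ => ((min (T σ) r : ℕ) : ℝ)) ν :=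
    Integrable.of_bound ((measurable_of_countable (fun n : ℕ => (n : ℝ))).comp (hTrm r)).aestronglyMeasurable r
      (ae_of_all _ fun σ => by
        rw [Real.norm_eq_abs, abs_of_nonneg (Nat.cast_nonneg _)]
        exact_mod_cast min_le_right _ _)
  have hc : 0 < 2 * ((r : ℝ) + 1) := by positivity
  obtain ⟨θ, hθ, hθi⟩ := hTi.exists_boundedContinuous_integral_sub_le (div_pos hε hc)
  have hmap : ∫ x, ‖((min (T x.2) r : ℕ) : ℝ) - θ x.2‖ ∂l =
      ∫ σ, ‖((min (T σ) r : ℕ) : ℝ) - θ σ‖ ∂ν :=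
    (integral_map measurable_snd.aemeasurable (hTi.sub hθi).norm.aestronglyMeasurable).symm
  have hDi : Integrable (fun x : Γ.K × Γ.Strategy => ‖((min (T x.2) r : ℕ) : ℝ) - θ x.2‖) l :=
    (hTi.sub hθi).norm.comp_measurable measurable_snd
  let φ : Γ.K × Γ.Strategy → ℝ := fun x => Γ.itp R r x.1 (θ x.2)
  have hφ : Continuous φ := Γ.continuous_itp R r θ θ.continuous
  have hφi : Integrable φ l := (Γ.memLp_cont l φ hφ).integrable (by norm_num)
  have s3 : ∫ x, R (min (T x.2) r) x.1 ∂l - ε ≤ ∫ x, φ x ∂l := by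
    have h1 : ∫ x, (R (min (T x.2) r) x.1 - φ x) ∂l ≤
        ∫ x, 2 * ((r : ℝ) + 1) * ‖((min (T x.2) r : ℕ) : ℝ) - θ x.2‖ ∂l := by
      refine integral_mono ((hRi _ (hTrm r)).sub hφi) (hDi.const_mul _) fun x => ?_
      have := Γ.itp_lip R hR r x.1 ((min (T x.2) r : ℕ) : ℝ) (θ x.2)
      rw [Γ.itp_nat R r x.1 _ (min_le_right _ _)] at this
      exact (le_abs_self _).trans this
    rw [integral_sub (hRi _ (hTrm r)) hφi, integral_const_mul, hmap] at h1
    have h2 := mul_le_mul_of_nonneg_left hθ hc.le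
    rw [mul_div_cancel₀ _ hc.ne'] at h2
    linarith
  -- choose a stage
  obtain ⟨n, hn⟩ := ((hlim φ hφ).eventually (lt_mem_nhds (sub_lt_self _ hε))).exists
  have hm : ∃ m ∈ Finset.range (n + 1), ∫ x, φ x ∂l - ε ≤ Γ.EE p1 σ0 m (fun z => φ (Γ.emb σ0 z)) := by
    by_contra! hcon
    have h1 := Finset.sum_le_sum fun m hm => (hcon m hm).le
    rw [Finset.sum_const, Finset.card_range, nsmul_eq_mul] at h1
    push_cast at h1
    have hpos : (0 : ℝ) < n + 1 := by positivity
    have h2 := mul_le_mul_of_nonneg_left h1 (one_div_pos.2 hpos).le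
    rw [← mul_assoc, one_div_mul_cancel hpos.ne', one_mul] at h2
    linarith
  obtain ⟨m, -, hm⟩ := hm
  obtain ⟨s, hs⟩ := Γ.select p1 hp σ0 m R hR r θ
  refine ⟨Γ.concat σ0 m (fun h => τ (s h)), Γ.concat_fm _ _ _ fun h => hfm _, ?_⟩
  have hfin : Γ.EE p1 σ0 m (fun z => R (s z.2) z.1) ≤ _ :=
    Γ.concat_pay p1 hp.1 σ0 m (fun h => τ (s h)) (fun k h => R (s h) k) (fun k h => hRG _ _) (fun k h => hR _ _)
  have hm2 : Γ.EE p1 σ0 m (fun z => φ (Γ.emb σ0 z)) ≤ Γ.EE p1 σ0 m (fun z => R (s z.2) z.1) := hs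
  linarith

end POMDP

/-- The value of a POMDP is the supremum of the long-run average payoff over
finite-memory strategies. -/
theorem val_eq_sSup_finiteMemory (Γ : POMDP) (p1 : Γ.K → ℝ) (hp1 : IsBelief p1) :
    Γ.val p1 = sSup {x : ℝ | ∃ σ : Γ.Strategy, Γ.FiniteMemory σ ∧ Γ.pay p1 σ = x} := by
  have hb : BddAbove (Set.range fun σ : Γ.Strategy => Γ.pay p1 σ) :=
    ⟨1, by rintro _ ⟨σ, rfl⟩; exact Γ.pay_le_one p1 hp1 σ⟩
  have hb2 : BddAbove {x : ℝ | ∃ σ : Γ.Strategy, Γ.FiniteMemory σ ∧ Γ.pay p1 σ = x} :=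
    ⟨1, by rintro _ ⟨σ, -, rfl⟩; exact Γ.pay_le_one p1 hp1 σ⟩
  have hne : Nonempty Γ.Strategy := inferInstance
  obtain ⟨σ1⟩ := hne
  apply le_antisymm
  · refine ciSup_le fun σ0 => le_of_forall_pos_le_add fun δ hδ => ?_
    obtain ⟨τ, h1, h2⟩ := Γ.approx p1 hp1 σ0 (δ / 6) (by positivity)
    have := le_csSup hb2 ⟨τ, h1, rfl⟩
    linarith
  · refine csSup_le ⟨_, _, Γ.fm_const (σ1 []), rfl⟩ ?_
    rintro _ ⟨σ, -, rfl⟩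
    exact le_ciSup hb σ


end PomdpPaper
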